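/- arXiv:2403.07298 — 2 statements merged into one kernel-verified Lean document; each statement's English description precedes it below -/
import Mathlib

section
/- For all real a with 0 ≤ a ≤ 1, ∫₀¹ K(2√(x(1-x))) / √(1 - 2(2x-1)a + a²) dx = [K(√((1-√(1+a²))/2))]², where K is extended to complex moduli via its hypergeometric series in k² (the value depends only on k²). -/
open MeasureTheory Real Filter

/-- Pochhammer symbol `(x)_n`. -/
noncomputable def poch (x : ℝ) (n : ℕ) : ℝ := ∏ i ∈ Finset.range n, (x + i)

/-- Complete elliptic integral of the first kind. -/
noncomputable def K (k : ℝ) : ℝ :=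
  ∫ θ in Set.Ioo 0 (Real.pi / 2), 1 / Real.sqrt (1 - k ^ 2 * Real.sin θ ^ 2)

/-- `K` as a function of the squared modulus, via the hypergeometric series
`K(k) = (π/2) ₂F₁(1/2,1/2;1;k²)`. -/
noncomputable def Ksq (m : ℝ) : ℝ :=
  (Real.pi / 2) * ∑' n : ℕ, poch (1/2) n ^ 2 / poch 1 n ^ 2 * m ^ n

/-- Legendre polynomial `P_n(x)`. -/
noncomputable def P (n : ℕ) (x : ℝ) : ℝ :=
  (1 / 2 ^ n) * ∑ k ∈ Finset.range (n + 1), (n.choose k : ℝ) ^ 2 * (x - 1) ^ (n - k) * (x + 1) ^ k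

open Topology

/-- The normalised central binomial coefficient `(1/2)_n / (1)_n`. -/
noncomputable def halfCoeff (n : ℕ) : ℝ := poch (1 / 2) n / poch 1 n

lemma poch_succ (x : ℝ) (n : ℕ) : poch x (n + 1) = poch x n * (x + n) := by
  simp [poch, Finset.prod_range_succ]

lemma poch_pos {x : ℝ} (hx : 0 < x) (n : ℕ) : 0 < poch x n :=
  Finset.prod_pos fun i _ => by positivity

lemma halfCoeff_zero : halfCoeff 0 = 1 := by simp [halfCoeff, poch]

lemma halfCoeff_succ (n : ℕ) : halfCoeff (n + 1) = halfCoeff n * ((n + 1 / 2) / (n + 1)) := by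
  rw [halfCoeff, halfCoeff, poch_succ, poch_succ, mul_div_mul_comm, add_comm (1 / 2 : ℝ),
    add_comm (1 : ℝ)]

lemma halfCoeff_pos (n : ℕ) : 0 < halfCoeff n :=
  div_pos (poch_pos (by norm_num) n) (poch_pos one_pos n)

lemma halfCoeff_sq_mul_le (n : ℕ) : halfCoeff n ^ 2 * (2 * n + 1) ≤ 1 := by
  induction n with
  | zero => simp [halfCoeff_zero]
  | succ n ih =>
    rw [halfCoeff_succ]
    push_cast
    have hn : (0 : ℝ) ≤ n := n.cast_nonneg
    have h : ((n + 1 / 2 : ℝ) / (n + 1)) ^ 2 * (2 * (n + 1) + 1) ≤ 2 * n + 1 := by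
      rw [div_pow, div_mul_eq_mul_div, div_le_iff₀ (by positivity)]
      nlinarith
    calc _ = halfCoeff n ^ 2 * (((n + 1 / 2 : ℝ) / (n + 1)) ^ 2 * (2 * (n + 1) + 1)) := by ring
      _ ≤ halfCoeff n ^ 2 * (2 * n + 1) := by gcongr
      _ ≤ 1 := ih

lemma halfCoeff_le_one (n : ℕ) : halfCoeff n ≤ 1 := by
  have h := halfCoeff_sq_mul_le n
  have hn : (0 : ℝ) ≤ n := n.cast_nonneg
  nlinarith [halfCoeff_pos n, mul_nonneg (sq_nonneg (halfCoeff n)) hn]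

/-- The coefficients `(1/2)_{2 n} (1/2)_n² / ((1)_{2 n} (1)_n²)` of `₃F₂(1/4, 1/2, 3/4; 1, 1; ·)`. -/
noncomputable def quarterCoeff (n : ℕ) : ℝ := halfCoeff (2 * n) * halfCoeff n ^ 2

lemma quarterCoeff_pos (n : ℕ) : 0 < quarterCoeff n :=
  mul_pos (halfCoeff_pos _) (pow_pos (halfCoeff_pos _) 2)

lemma quarterCoeff_le_one (n : ℕ) : quarterCoeff n ≤ 1 :=
  mul_le_one₀ (halfCoeff_le_one _) (by positivity)
    (pow_le_one₀ (halfCoeff_pos n).le (halfCoeff_le_one n))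

lemma quarterCoeff_succ (n : ℕ) : ((n : ℝ) + 1) ^ 3 * quarterCoeff (n + 1) =
    (n + 1 / 4) * (n + 1 / 2) * (n + 3 / 4) * quarterCoeff n := by
  have hn : (0 : ℝ) ≤ n := n.cast_nonneg
  rw [quarterCoeff, quarterCoeff, show 2 * (n + 1) = 2 * n + 1 + 1 by ring, halfCoeff_succ,
    halfCoeff_succ, halfCoeff_succ]
  push_cast
  field_simp
  ring

lemma summable_quarterCoeff : Summable quarterCoeff := by
  have hs : Summable fun n : ℕ => 1 / ((n + 1 : ℕ) : ℝ) ^ (3 / 2 : ℝ) :=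
    (summable_nat_add_iff 1).2 (Real.summable_one_div_nat_rpow.2 (by norm_num))
  refine hs.of_nonneg_of_le (fun n => (quarterCoeff_pos n).le) fun n => ?_
  have hn : (0 : ℝ) < ((n + 1 : ℕ) : ℝ) := by positivity
  have hn0 : (0 : ℝ) ≤ n := n.cast_nonneg
  have h1 : halfCoeff n ^ 2 ≤ 1 / ((n + 1 : ℕ) : ℝ) := by
    rw [le_div_iff₀ hn]
    push_cast
    nlinarith [halfCoeff_sq_mul_le n, mul_nonneg (sq_nonneg (halfCoeff n)) hn0]
  have h2 : halfCoeff (2 * n) ≤ 1 / √((n + 1 : ℕ) : ℝ) := by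
    rw [← Real.sqrt_one, ← Real.sqrt_div zero_le_one]
    apply Real.le_sqrt_of_sq_le
    rw [le_div_iff₀ hn]
    have := halfCoeff_sq_mul_le (2 * n)
    push_cast at this ⊢
    nlinarith [mul_nonneg (sq_nonneg (halfCoeff (2 * n))) hn0]
  have h3 : ((n + 1 : ℕ) : ℝ) ^ (3 / 2 : ℝ) = √((n + 1 : ℕ) : ℝ) * ((n + 1 : ℕ) : ℝ) := by
    rw [show (3 / 2 : ℝ) = 1 / 2 + 1 by norm_num, Real.rpow_add hn, Real.rpow_one,
      Real.sqrt_eq_rpow]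
  calc quarterCoeff n ≤ 1 / √((n + 1 : ℕ) : ℝ) * (1 / ((n + 1 : ℕ) : ℝ)) :=
        mul_le_mul h2 h1 (by positivity) (by positivity)
    _ = _ := by rw [h3]; field_simp

/-- The sum of the power series with coefficients `c`. -/
noncomputable def powSum (c : ℕ → ℝ) (x : ℝ) : ℝ := ∑' n, c n * x ^ n

/-- Polynomial growth of a sequence of coefficients. -/
def PolyBounded (c : ℕ → ℝ) : Prop := ∃ j : ℕ, ∀ n : ℕ, |c n| ≤ ((n : ℝ) + 1) ^ j

lemma PolyBounded.nat_mul {c : ℕ → ℝ} (hc : PolyBounded c) : PolyBounded fun n => n * c n := by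
  obtain ⟨j, hj⟩ := hc
  refine ⟨j + 1, fun n => ?_⟩
  rw [abs_mul, Nat.abs_cast, pow_succ']
  exact mul_le_mul (by linarith) (hj n) (abs_nonneg _) (by positivity)

lemma summable_add_one_pow_mul_geometric (j : ℕ) {r : ℝ} (h0 : 0 < r) (h1 : r < 1) :
    Summable fun n : ℕ => ((n : ℝ) + 1) ^ j * r ^ n := by
  have h := (summable_nat_add_iff 1).2 (summable_pow_mul_geometric_of_norm_lt_one (R := ℝ) j
    (r := r) (by rwa [Real.norm_eq_abs, abs_of_pos h0]))
  refine (h.mul_right r⁻¹).congr fun n => ?_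
  rw [pow_succ]
  push_cast
  field_simp

lemma PolyBounded.summable_abs {c : ℕ → ℝ} (hc : PolyBounded c) {r : ℝ} (h0 : 0 < r)
    (h1 : r < 1) : Summable fun n => |c n| * r ^ n := by
  obtain ⟨j, hj⟩ := hc
  exact (summable_add_one_pow_mul_geometric j h0 h1).of_nonneg_of_le (fun n => by positivity)
    fun n => by gcongr; exact hj n

lemma PolyBounded.summable {c : ℕ → ℝ} (hc : PolyBounded c) {x : ℝ} (hx : |x| < 1) :
    Summable fun n => c n * x ^ n := by
  obtain ⟨r, hxr, hr1⟩ := exists_between hx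
  have h0 : 0 < r := (abs_nonneg x).trans_lt hxr
  refine (hc.summable_abs h0 hr1).of_norm_bounded fun n => ?_
  rw [norm_mul, norm_pow, Real.norm_eq_abs, Real.norm_eq_abs]
  gcongr

lemma PolyBounded.analyticAt {c : ℕ → ℝ} (hc : PolyBounded c) {x : ℝ} (hx : |x| < 1) :
    AnalyticAt ℝ (powSum c) x := by
  obtain ⟨r, hxr, hr1⟩ := exists_between hx
  have h0 : 0 < r := (abs_nonneg x).trans_lt hxr
  lift r to NNReal using h0.le
  set p := FormalMultilinearSeries.ofScalars ℝ c
  have hrad : (r : ENNReal) ≤ p.radius := by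
    refine p.le_radius_of_summable ?_
    refine (hc.summable_abs h0 hr1).congr fun n => ?_
    simp [p]
  have hp : 0 < p.radius := lt_of_lt_of_le (by exact_mod_cast h0) hrad
  have heq : p.sum = powSum c := by
    funext y
    change FormalMultilinearSeries.ofScalarsSum c y = _
    rw [FormalMultilinearSeries.ofScalars_sum_eq]
    simp [powSum]
  rw [← heq]
  refine (p.hasFPowerSeriesOnBall hp).analyticAt_of_mem ?_
  rw [Metric.mem_eball, edist_zero_right]
  refine lt_of_lt_of_le ?_ hrad
  rw [← ofReal_norm, Real.norm_eq_abs, ← ENNReal.ofReal_coe_nnreal]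
  exact (ENNReal.ofReal_lt_ofReal_iff h0).2 hxr

lemma PolyBounded.mul_deriv {c : ℕ → ℝ} (hc : PolyBounded c) {x : ℝ} (hx : |x| < 1) :
    x * deriv (powSum c) x = powSum (fun n => n * c n) x := by
  obtain ⟨r, hxr, hr1⟩ := exists_between hx
  have h0 : 0 < r := (abs_nonneg x).trans_lt hxr
  have hs := (hc.nat_mul.summable_abs h0 hr1).mul_right r⁻¹
  have hd := hasDerivAt_tsum_of_isPreconnected (𝕜 := ℝ) (t := Metric.ball (0 : ℝ) r)
    (g := fun n y => c n * y ^ n) (g' := fun n y => c n * (n * y ^ (n - 1))) hs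
    Metric.isOpen_ball (convex_ball _ _).isPreconnected
    (fun n y _ => (hasDerivAt_pow n y).const_mul (c n))
    (fun n y hy => by
      have hy' : |y| < r := by simpa using hy
      rcases n with _ | n
      · simp
      · have : |y| ^ n ≤ r ^ n := by gcongr
        rw [norm_mul, norm_mul, norm_pow, Real.norm_eq_abs, Real.norm_eq_abs, Real.norm_eq_abs,
          abs_mul, Nat.add_sub_cancel, pow_succ, mul_assoc _ _ r⁻¹, mul_assoc _ r,
          mul_inv_cancel₀ h0.ne']
        calc _ = |((n + 1 : ℕ) : ℝ)| * |c (n + 1)| * |y| ^ n := by ring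
          _ ≤ _ := by rw [mul_one]; gcongr)
    (y₀ := 0) (by simpa using h0) (hc.summable (by simp)) (y := x) (by simpa using hxr)
  have hd' : HasDerivAt (powSum c) _ x := hd
  rw [hd'.deriv, ← tsum_mul_left]
  refine tsum_congr fun n => ?_
  rcases n with _ | n
  · simp
  · rw [Nat.add_sub_cancel, pow_succ]; ring

lemma PolyBounded.powSum_eq {c : ℕ → ℝ} (hc : PolyBounded c) {x : ℝ} (hx : |x| < 1) :
    powSum c x = c 0 + x * powSum (fun n => c (n + 1)) x := by
  rw [powSum, (hc.summable hx).tsum_eq_zero_add, powSum, ← tsum_mul_left]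
  simp only [pow_zero, mul_one, pow_succ]
  congr 1
  exact tsum_congr fun n => by ring

lemma polyBounded_of_le_one {c : ℕ → ℝ} (h0 : ∀ n, 0 ≤ c n) (h1 : ∀ n, c n ≤ 1) :
    PolyBounded c := ⟨0, fun n => by rw [abs_of_nonneg (h0 n), pow_zero]; exact h1 n⟩

lemma polyBounded_halfCoeff_sq : PolyBounded fun n => halfCoeff n ^ 2 :=
  polyBounded_of_le_one (fun n => by positivity)
    fun n => pow_le_one₀ (halfCoeff_pos n).le (halfCoeff_le_one n)

lemma polyBounded_quarterCoeff : PolyBounded quarterCoeff :=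
  polyBounded_of_le_one (fun n => (quarterCoeff_pos n).le) quarterCoeff_le_one

/-- `₂F₁(1/2, 1/2; 1; ·)`. -/
noncomputable def hypF : ℝ → ℝ := powSum fun n => halfCoeff n ^ 2

/-- The image of `hypF` under the Euler operator `θ = m d/dm`. -/
noncomputable def hypE : ℝ → ℝ := powSum fun n => n * halfCoeff n ^ 2

lemma hypE_mul_deriv {m : ℝ} (hm : |m| < 1) :
    (1 - m) * (m * deriv hypE m) = m * (hypE m + hypF m / 4) := by
  have hF := polyBounded_halfCoeff_sq
  have hE := hF.nat_mul
  have hE2 := hE.nat_mul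
  have h1 : m * deriv hypE m = _ := hE.mul_deriv hm
  have h2 : powSum (fun n => n * (n * halfCoeff n ^ 2)) m =
      m * (powSum (fun n => n * (n * halfCoeff n ^ 2)) m + hypE m + hypF m / 4) := by
    conv_lhs => rw [hE2.powSum_eq hm]
    rw [hypE, hypF, powSum, powSum, powSum, powSum, ← tsum_div_const,
      ← (hE2.summable hm).tsum_add (hE.summable hm),
      ← ((hE2.summable hm).add (hE.summable hm)).tsum_add ((hF.summable hm).div_const 4)]
    simp only [Nat.cast_zero, zero_mul, zero_add]
    congr 1
    refine tsum_congr fun n => ?_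
    have hn : ((n : ℝ) + 1) ≠ 0 := by positivity
    rw [halfCoeff_succ]
    push_cast
    field_simp
    ring
  rw [h1]
  linarith

/-- `₃F₂(1/4, 1/2, 3/4; 1, 1; ·)`. -/
noncomputable def hypG : ℝ → ℝ := powSum quarterCoeff

/-- The image of `hypG` under the Euler operator. -/
noncomputable def hypG₁ : ℝ → ℝ := powSum fun n => n * quarterCoeff n

/-- The image of `hypG` under the square of the Euler operator. -/
noncomputable def hypG₂ : ℝ → ℝ := powSum fun n => n * (n * quarterCoeff n)

lemma hypG₂_mul_deriv {t : ℝ} (ht : |t| < 1) :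
    (1 - t) * (t * deriv hypG₂ t) =
      t * (3 / 2 * hypG₂ t + 11 / 16 * hypG₁ t + 3 / 32 * hypG t) := by
  have h0 := polyBounded_quarterCoeff
  have h1 := h0.nat_mul
  have h2 := h1.nat_mul
  have h3 := h2.nat_mul
  have hd : t * deriv hypG₂ t = _ := h2.mul_deriv ht
  have h : powSum (fun n => n * (n * (n * quarterCoeff n))) t =
      t * (powSum (fun n => n * (n * (n * quarterCoeff n))) t + 3 / 2 * hypG₂ t +
        11 / 16 * hypG₁ t + 3 / 32 * hypG t) := by
    conv_lhs => rw [h3.powSum_eq ht]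
    rw [hypG, hypG₁, hypG₂, powSum, powSum, powSum, powSum, powSum,
      ← tsum_mul_left, ← tsum_mul_left, ← tsum_mul_left, ← tsum_mul_left,
      ← (h3.summable ht).tsum_add ((h2.summable ht).mul_left _),
      ← ((h3.summable ht).add ((h2.summable ht).mul_left _)).tsum_add
        ((h1.summable ht).mul_left _),
      ← (((h3.summable ht).add ((h2.summable ht).mul_left _)).add
        ((h1.summable ht).mul_left _)).tsum_add ((h0.summable ht).mul_left _)]
    simp only [Nat.cast_zero, zero_mul, zero_add]
    rw [← tsum_mul_left]
    refine tsum_congr fun n => ?_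
    have := quarterCoeff_succ n
    push_cast
    linear_combination t * t ^ n * this
  rw [hd]
  linarith

/-- If `u = m ^ k u₁` near `0` and `m du/dm = r v` with `r 0 ≠ 0`, then `v` is divisible by `m ^ k`,
and the quotient has value `k u₁(0) / r(0)` at `0`. -/
lemma exists_eventuallyEq_pow_mul_of_euler {u v r u₁ : ℝ → ℝ} {k : ℕ}
    (hu₁ : AnalyticAt ℝ u₁ 0) (hu : ∀ᶠ m in 𝓝 (0 : ℝ), u m = m ^ k * u₁ m)
    (hr : AnalyticAt ℝ r 0) (hr0 : r 0 ≠ 0) (huv : ∀ᶠ m in 𝓝 (0 : ℝ), m * deriv u m = r m * v m) :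
    ∃ v₁ : ℝ → ℝ, AnalyticAt ℝ v₁ 0 ∧ (∀ᶠ m in 𝓝 (0 : ℝ), v m = m ^ k * v₁ m) ∧
      v₁ 0 * r 0 = k * u₁ 0 := by
  refine ⟨fun m => (k * u₁ m + m * deriv u₁ m) / r m,
    ((analyticAt_const.mul hu₁).add (analyticAt_id.mul hu₁.deriv)).div hr hr0, ?_, ?_⟩
  · filter_upwards [hu.eventually_nhds, huv, hr.continuousAt.eventually_ne hr0,
      hu₁.eventually_analyticAt] with m h1 h2 h3 h4
    have hd : deriv u m = k * m ^ (k - 1) * u₁ m + m ^ k * deriv u₁ m := by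
      rw [Filter.EventuallyEq.deriv_eq h1]
      exact ((hasDerivAt_pow k m).mul h4.differentiableAt.hasDerivAt).deriv
    have hk : m * (k * m ^ (k - 1)) = k * m ^ k := by
      rcases k with _ | k
      · simp
      · rw [Nat.add_sub_cancel, pow_succ]; ring
    rw [mul_div_assoc', eq_div_iff h3, mul_comm (v m), ← h2, hd]
    linear_combination u₁ m * hk
  · simp only [zero_mul, add_zero]
    field_simp

/-- Uniqueness at a regular singular point: an analytic solution of a third order linear equation,
written with the Euler operator, whose indicial equation has `0` as its only root. -/
lemma eventually_eq_zero_of_euler_system {u v w r α β γ : ℝ → ℝ} (hu : AnalyticAt ℝ u 0)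
    (hu0 : u 0 = 0) (hr : AnalyticAt ℝ r 0) (hr0 : r 0 ≠ 0) (hα : ContinuousAt α 0)
    (hβ : ContinuousAt β 0) (hγ : ContinuousAt γ 0)
    (huv : ∀ᶠ m in 𝓝 (0 : ℝ), m * deriv u m = r m * v m)
    (hvw : ∀ᶠ m in 𝓝 (0 : ℝ), m * deriv v m = r m * w m)
    (hw : ∀ᶠ m in 𝓝 (0 : ℝ), m * deriv w m = m * (α m * u m + β m * v m + γ m * w m)) :
    ∀ᶠ m in 𝓝 (0 : ℝ), u m = 0 := by
  by_contra hne
  obtain ⟨k, u₁, hu₁, hu₁0, hk⟩ := hu.exists_eventuallyEq_pow_smul_nonzero_iff.2 hne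
  simp only [sub_zero, smul_eq_mul] at hk
  have hk0 : k ≠ 0 := by
    rintro rfl
    have := hk.self_of_nhds
    rw [hu0, pow_zero, one_mul] at this
    exact hu₁0 this.symm
  obtain ⟨v₁, hv₁, hv, hv0⟩ := exists_eventuallyEq_pow_mul_of_euler hu₁ hk hr hr0 huv
  obtain ⟨w₁, hw₁, hww, hw0⟩ := exists_eventuallyEq_pow_mul_of_euler hv₁ hv hr hr0 hvw
  obtain ⟨x₁, hx₁, hx, hx0⟩ := exists_eventuallyEq_pow_mul_of_euler (r := fun _ => 1)
    (v := fun m => m * (α m * u m + β m * v m + γ m * w m)) hw₁ hww analyticAt_const one_ne_zero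
    (by simpa using hw)
  have key : ∀ᶠ m in 𝓝[≠] (0 : ℝ), x₁ m = m * (α m * u₁ m + β m * v₁ m + γ m * w₁ m) := by
    filter_upwards [hk.filter_mono nhdsWithin_le_nhds, hv.filter_mono nhdsWithin_le_nhds,
      hww.filter_mono nhdsWithin_le_nhds, hx.filter_mono nhdsWithin_le_nhds,
      self_mem_nhdsWithin] with m h1 h2 h3 h4 h5
    have hm : m ^ k ≠ 0 := pow_ne_zero _ h5
    apply mul_left_cancel₀ hm
    rw [← h4, h1, h2, h3]
    ring
  have hlim : Tendsto (fun m => m * (α m * u₁ m + β m * v₁ m + γ m * w₁ m)) (𝓝[≠] 0) (𝓝 0) := by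
    have hc : ContinuousAt (fun m => m * (α m * u₁ m + β m * v₁ m + γ m * w₁ m)) 0 :=
      continuousAt_id.mul (((hα.mul hu₁.continuousAt).add (hβ.mul hv₁.continuousAt)).add
        (hγ.mul hw₁.continuousAt))
    have := hc.tendsto.mono_left (nhdsWithin_le_nhds (s := {0}ᶜ))
    simpa using this
  have hx10 : x₁ 0 = 0 := tendsto_nhds_unique
    (hx₁.continuousAt.tendsto.mono_left (nhdsWithin_le_nhds (s := {0}ᶜ)))
    (hlim.congr' (key.mono fun m h => h.symm))
  have hkr : (k : ℝ) ≠ 0 := Nat.cast_ne_zero.2 hk0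
  have hw10 : w₁ 0 = 0 := by
    rw [hx10, zero_mul] at hx0
    exact (mul_eq_zero.1 hx0.symm).resolve_left hkr
  have hv10 : v₁ 0 = 0 := by
    rw [hw10, zero_mul] at hw0
    exact (mul_eq_zero.1 hw0.symm).resolve_left hkr
  rw [hv10, zero_mul] at hv0
  exact hu₁0 ((mul_eq_zero.1 hv0.symm).resolve_left hkr)

lemma hasDerivAt_of_eq_polynomial {f : ℝ → ℝ} (a₀ a₁ a₂ a₃ a₄ a₅ a₆ a₇ : ℝ)
    (hf : ∀ x, f x = a₀ + a₁ * x + a₂ * x ^ 2 + a₃ * x ^ 3 + a₄ * x ^ 4 + a₅ * x ^ 5 + a₆ * x ^ 6 +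
      a₇ * x ^ 7) (x : ℝ) :
    HasDerivAt f (a₁ + 2 * a₂ * x + 3 * a₃ * x ^ 2 + 4 * a₄ * x ^ 3 + 5 * a₅ * x ^ 4 +
      6 * a₆ * x ^ 5 + 7 * a₇ * x ^ 6) x := by
  rw [funext hf]
  have h := (((((((hasDerivAt_const x a₀).fun_add ((hasDerivAt_id' x).const_mul a₁)).fun_add
    ((hasDerivAt_pow 2 x).const_mul a₂)).fun_add ((hasDerivAt_pow 3 x).const_mul a₃)).fun_add
    ((hasDerivAt_pow 4 x).const_mul a₄)).fun_add ((hasDerivAt_pow 5 x).const_mul a₅)).fun_add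
    ((hasDerivAt_pow 6 x).const_mul a₆)).fun_add ((hasDerivAt_pow 7 x).const_mul a₇)
  refine h.congr_deriv ?_
  norm_num
  ring

/-- The degree four change of variable relating `hypF ^ 2` to `hypG`. -/
noncomputable def modulusMap (m : ℝ) : ℝ := 16 * m * (m - 1) / (1 - 2 * m) ^ 4

/-- The logarithmic derivative of `modulusMap` with respect to the Euler operator. -/
noncomputable def modulusRate (m : ℝ) : ℝ := (1 + 4 * m - 4 * m ^ 2) / ((1 - 2 * m) * (1 - m))

lemma modulusMap_hasDerivAt {m : ℝ} (h2 : 1 - 2 * m ≠ 0) (h1 : 1 - m ≠ 0) :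
    ∃ d, HasDerivAt modulusMap d m ∧ m * d = modulusRate m * modulusMap m := by
  have hN := hasDerivAt_of_eq_polynomial (f := fun m => 16 * m * (m - 1)) 0 (-16) 16 0 0 0 0 0
    (fun x => by ring) m
  have hD := hasDerivAt_of_eq_polynomial (f := fun m => (1 - 2 * m) ^ 4) 1 (-8) 24 (-32) 16 0 0 0
    (fun x => by ring) m
  have h2' : 1 - m * 2 ≠ 0 := by rwa [mul_comm]
  refine ⟨_, hN.fun_div hD (pow_ne_zero 4 h2), ?_⟩
  rw [modulusRate, modulusMap]
  field_simp
  ring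

lemma one_sub_modulusMap {m : ℝ} (h2 : 1 - 2 * m ≠ 0) :
    1 - modulusMap m = (1 + 4 * m - 4 * m ^ 2) ^ 2 / (1 - 2 * m) ^ 4 := by
  have h2' : 1 - m * 2 ≠ 0 := by rwa [mul_comm]
  rw [modulusMap]
  field_simp
  ring

lemma euler_comp_modulusMap {c : ℕ → ℝ} (hc : PolyBounded c) {m : ℝ} (h2 : 1 - 2 * m ≠ 0)
    (h1 : 1 - m ≠ 0) (hφ : |modulusMap m| < 1) :
    ∃ d, HasDerivAt (fun m => powSum c (modulusMap m)) d m ∧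
      m * d = modulusRate m * powSum (fun n => n * c n) (modulusMap m) := by
  obtain ⟨d, hd, hmd⟩ := modulusMap_hasDerivAt h2 h1
  refine ⟨_, (hc.analyticAt hφ).differentiableAt.hasDerivAt.comp m hd, ?_⟩
  rw [← hc.mul_deriv hφ]
  linear_combination deriv (powSum c) (modulusMap m) * hmd

lemma euler_hypG₂_comp_modulusMap {m : ℝ} (h2 : 1 - 2 * m ≠ 0) (h1 : 1 - m ≠ 0)
    (hD : 1 + 4 * m - 4 * m ^ 2 ≠ 0) (hφ : |modulusMap m| < 1) :
    ∃ d, HasDerivAt (fun m => hypG₂ (modulusMap m)) d m ∧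
      m * d = m * (-16 / ((1 + 4 * m - 4 * m ^ 2) * (1 - 2 * m)) * (3 / 2 * hypG₂ (modulusMap m) +
        11 / 16 * hypG₁ (modulusMap m) + 3 / 32 * hypG (modulusMap m))) := by
  obtain ⟨d, hd, hmd⟩ := modulusMap_hasDerivAt h2 h1
  refine ⟨_, (polyBounded_quarterCoeff.nat_mul.nat_mul.analyticAt
    hφ).differentiableAt.hasDerivAt.comp m hd, ?_⟩
  have h := hypG₂_mul_deriv hφ
  change m * (deriv hypG₂ (modulusMap m) * d) = _
  generalize deriv hypG₂ (modulusMap m) = g at *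
  generalize 3 / 2 * hypG₂ (modulusMap m) + 11 / 16 * hypG₁ (modulusMap m) +
    3 / 32 * hypG (modulusMap m) = y at *
  have hne : 1 - modulusMap m ≠ 0 := by rw [one_sub_modulusMap h2]; positivity
  have h3 : m * (g * d) = modulusRate m * (modulusMap m * y / (1 - modulusMap m)) := by
    rw [← h]
    field_simp
    linear_combination g * hmd
  have h2' : 1 - m * 2 ≠ 0 := by rwa [mul_comm]
  have hD' : 1 + m * 4 - m ^ 2 * 4 ≠ 0 := by rwa [mul_comm m, mul_comm (m ^ 2)]
  rw [h3, one_sub_modulusMap h2, modulusRate, modulusMap]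
  field_simp
  ring

lemma euler_hypF {m : ℝ} (hm : |m| < 1) : ∃ d, HasDerivAt hypF d m ∧ m * d = hypE m :=
  ⟨_, (polyBounded_halfCoeff_sq.analyticAt hm).differentiableAt.hasDerivAt,
    polyBounded_halfCoeff_sq.mul_deriv hm⟩

lemma euler_hypE {m : ℝ} (hm : |m| < 1) :
    ∃ d, HasDerivAt hypE d m ∧ m * d = m * (hypE m + hypF m / 4) / (1 - m) := by
  refine ⟨_, (polyBounded_halfCoeff_sq.nat_mul.analyticAt hm).differentiableAt.hasDerivAt, ?_⟩
  have h1 : 1 - m ≠ 0 := by have := (abs_lt.1 hm).2; linarith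
  rw [eq_div_iff h1, ← hypE_mul_deriv hm, mul_comm]
  rfl

/-- `(1 - 2 m) hypF²` after one application of the Euler operator divided by `modulusRate`. -/
noncomputable def hypFSq₁ (m : ℝ) : ℝ :=
  ((-2 * m + 6 * m ^ 2 - 4 * m ^ 3) * hypF m ^ 2 +
    (2 - 10 * m + 16 * m ^ 2 - 8 * m ^ 3) * (hypF m * hypE m)) / (1 + 4 * m - 4 * m ^ 2)

/-- `(1 - 2 m) hypF²` after two applications of the Euler operator divided by `modulusRate`. -/
noncomputable def hypFSq₂ (m : ℝ) : ℝ :=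
  ((-3 / 2 * m + 33 / 2 * m ^ 2 - 43 * m ^ 3 + 20 * m ^ 4 + 48 * m ^ 5 - 56 * m ^ 6 + 16 * m ^ 7) *
      hypF m ^ 2 +
    (-20 * m + 104 * m ^ 2 - 148 * m ^ 3 - 64 * m ^ 4 + 320 * m ^ 5 - 256 * m ^ 6 + 64 * m ^ 7) *
      (hypF m * hypE m) +
    (2 - 8 * m - 22 * m ^ 2 + 188 * m ^ 3 - 448 * m ^ 4 + 512 * m ^ 5 - 288 * m ^ 6 + 64 * m ^ 7) *
      hypE m ^ 2) / (1 + 4 * m - 4 * m ^ 2) ^ 3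

lemma euler_hypFSq {m : ℝ} (hm : |m| < 1) (h2 : 1 - 2 * m ≠ 0)
    (hD : 1 + 4 * m - 4 * m ^ 2 ≠ 0) :
    ∃ d, HasDerivAt (fun m => (1 - 2 * m) * hypF m ^ 2) d m ∧
      m * d = modulusRate m * hypFSq₁ m := by
  have h1 : 1 - m ≠ 0 := by have := (abs_lt.1 hm).2; linarith
  obtain ⟨f, hf, hmf⟩ := euler_hypF hm
  have hs := hasDerivAt_of_eq_polynomial (f := fun m => 1 - 2 * m) 1 (-2) 0 0 0 0 0 0
    (fun x => by ring) m
  refine ⟨_, hs.fun_mul (hf.fun_pow 2), ?_⟩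
  have h2' : 1 - m * 2 ≠ 0 := by rwa [mul_comm]
  have hD' : 1 + m * 4 - m ^ 2 * 4 ≠ 0 := by rwa [mul_comm m, mul_comm (m ^ 2)]
  rw [modulusRate, hypFSq₁]
  generalize hypE m = e at *
  subst hmf
  field_simp
  ring

lemma euler_hypFSq₁ {m : ℝ} (hm : |m| < 1) (h2 : 1 - 2 * m ≠ 0)
    (hD : 1 + 4 * m - 4 * m ^ 2 ≠ 0) :
    ∃ d, HasDerivAt hypFSq₁ d m ∧ m * d = modulusRate m * hypFSq₂ m := by
  have h1 : 1 - m ≠ 0 := by have := (abs_lt.1 hm).2; linarith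
  obtain ⟨f, hf, hmf⟩ := euler_hypF hm
  obtain ⟨e, he, hme⟩ := euler_hypE hm
  have hA := hasDerivAt_of_eq_polynomial (f := fun m => -2 * m + 6 * m ^ 2 - 4 * m ^ 3)
    0 (-2) 6 (-4) 0 0 0 0 (fun x => by ring) m
  have hB := hasDerivAt_of_eq_polynomial (f := fun m => 2 - 10 * m + 16 * m ^ 2 - 8 * m ^ 3)
    2 (-10) 16 (-8) 0 0 0 0 (fun x => by ring) m
  have hQ := hasDerivAt_of_eq_polynomial (f := fun m => 1 + 4 * m - 4 * m ^ 2)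
    1 4 (-4) 0 0 0 0 0 (fun x => by ring) m
  refine ⟨_, ((hA.fun_mul (hf.fun_pow 2)).fun_add (hB.fun_mul (hf.fun_mul he))).fun_div hQ hD, ?_⟩
  have h2' : 1 - m * 2 ≠ 0 := by rwa [mul_comm]
  have hD' : 1 + m * 4 - m ^ 2 * 4 ≠ 0 := by rwa [mul_comm m, mul_comm (m ^ 2)]
  rw [modulusRate, hypFSq₂]
  generalize hypE m = E at *
  generalize hypF m = F at *
  rw [eq_div_iff h1] at hme
  subst hmf
  field_simp
  linear_combination 2 * (2 - 10 * m + 16 * m ^ 2 - 8 * m ^ 3) * F * (1 + 4 * m - 4 * m ^ 2) *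
    (1 - 2 * m) * hme

lemma euler_hypFSq₂ {m : ℝ} (hm : |m| < 1) (h2 : 1 - 2 * m ≠ 0)
    (hD : 1 + 4 * m - 4 * m ^ 2 ≠ 0) :
    ∃ d, HasDerivAt hypFSq₂ d m ∧
      m * d = m * (-16 / ((1 + 4 * m - 4 * m ^ 2) * (1 - 2 * m)) * (3 / 2 * hypFSq₂ m +
        11 / 16 * hypFSq₁ m + 3 / 32 * ((1 - 2 * m) * hypF m ^ 2))) := by
  have h1 : 1 - m ≠ 0 := by have := (abs_lt.1 hm).2; linarith
  obtain ⟨f, hf, hmf⟩ := euler_hypF hm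
  obtain ⟨e, he, hme⟩ := euler_hypE hm
  have hA := hasDerivAt_of_eq_polynomial (f := fun m => -3 / 2 * m + 33 / 2 * m ^ 2 - 43 * m ^ 3 +
      20 * m ^ 4 + 48 * m ^ 5 - 56 * m ^ 6 + 16 * m ^ 7)
    0 (-3 / 2) (33 / 2) (-43) 20 48 (-56) 16 (fun x => by ring) m
  have hB := hasDerivAt_of_eq_polynomial (f := fun m => -20 * m + 104 * m ^ 2 - 148 * m ^ 3 -
      64 * m ^ 4 + 320 * m ^ 5 - 256 * m ^ 6 + 64 * m ^ 7)
    0 (-20) 104 (-148) (-64) 320 (-256) 64 (fun x => by ring) m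
  have hC := hasDerivAt_of_eq_polynomial (f := fun m => 2 - 8 * m - 22 * m ^ 2 + 188 * m ^ 3 -
      448 * m ^ 4 + 512 * m ^ 5 - 288 * m ^ 6 + 64 * m ^ 7)
    2 (-8) (-22) 188 (-448) 512 (-288) 64 (fun x => by ring) m
  have hQ := hasDerivAt_of_eq_polynomial (f := fun m => 1 + 4 * m - 4 * m ^ 2)
    1 4 (-4) 0 0 0 0 0 (fun x => by ring) m
  refine ⟨_, (((hA.fun_mul (hf.fun_pow 2)).fun_add (hB.fun_mul (hf.fun_mul he))).fun_add
    (hC.fun_mul (he.fun_pow 2))).fun_div (hQ.fun_pow 3) (pow_ne_zero 3 hD), ?_⟩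
  rw [hypFSq₁, hypFSq₂]
  have h2' : 1 - m * 2 ≠ 0 := by rwa [mul_comm]
  have hD' : 1 + m * 4 - m ^ 2 * 4 ≠ 0 := by rwa [mul_comm m, mul_comm (m ^ 2)]
  generalize hypE m = E at *
  generalize hypF m = F at *
  subst hmf
  linear_combination (norm := skip) ((-20 * m + 104 * m ^ 2 - 148 * m ^ 3 - 64 * m ^ 4 +
    320 * m ^ 5 - 256 * m ^ 6 + 64 * m ^ 7) * F + 2 * (2 - 8 * m - 22 * m ^ 2 + 188 * m ^ 3 -
    448 * m ^ 4 + 512 * m ^ 5 - 288 * m ^ 6 + 64 * m ^ 7) * (m * f)) /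
    (1 + 4 * m - 4 * m ^ 2) ^ 3 * hme
  field_simp
  ring

lemma modulusMap_zero : modulusMap 0 = 0 := by simp [modulusMap]

lemma continuousAt_modulusMap {m : ℝ} (h2 : 1 - 2 * m ≠ 0) : ContinuousAt modulusMap m := by
  unfold modulusMap
  exact ContinuousAt.div (by fun_prop) (by fun_prop) (pow_ne_zero 4 h2)

lemma analyticAt_modulusMap {m : ℝ} (h2 : 1 - 2 * m ≠ 0) : AnalyticAt ℝ modulusMap m := by
  unfold modulusMap
  exact AnalyticAt.div (by fun_prop) (by fun_prop) (pow_ne_zero 4 h2)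

lemma analyticAt_hypFSq {m : ℝ} (hm : |m| < 1) :
    AnalyticAt ℝ (fun m => (1 - 2 * m) * hypF m ^ 2) m :=
  AnalyticAt.mul (by fun_prop) ((polyBounded_halfCoeff_sq.analyticAt hm).pow 2)

lemma analyticAt_hypG_comp {m : ℝ} (h2 : 1 - 2 * m ≠ 0) (hφ : |modulusMap m| < 1) :
    AnalyticAt ℝ (fun m => hypG (modulusMap m)) m :=
  (polyBounded_quarterCoeff.analyticAt hφ).comp (analyticAt_modulusMap h2)

lemma powSum_zero (c : ℕ → ℝ) : powSum c 0 = c 0 := by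
  rw [powSum, tsum_eq_single 0 (fun n hn => by simp [hn])]
  simp

lemma eventually_hypFSq_eq :
    ∀ᶠ m in 𝓝 (0 : ℝ), (1 - 2 * m) * hypF m ^ 2 - hypG (modulusMap m) = 0 := by
  have e1 : ∀ᶠ m in 𝓝 (0 : ℝ), |m| < 1 :=
    (continuous_abs.continuousAt (x := (0 : ℝ))).eventually_lt_const (by simp)
  have e2 : ∀ᶠ m in 𝓝 (0 : ℝ), 1 - 2 * m ≠ 0 :=
    (by fun_prop : ContinuousAt (fun m : ℝ => 1 - 2 * m) 0).eventually_ne (by simp)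
  have e3 : ∀ᶠ m in 𝓝 (0 : ℝ), 1 + 4 * m - 4 * m ^ 2 ≠ 0 :=
    (by fun_prop : ContinuousAt (fun m : ℝ => 1 + 4 * m - 4 * m ^ 2) 0).eventually_ne (by simp)
  have e4 : ∀ᶠ m in 𝓝 (0 : ℝ), |modulusMap m| < 1 :=
    (continuousAt_modulusMap (m := 0) (by simp)).abs.eventually_lt_const
      (by simp [modulusMap_zero])
  have hr : AnalyticAt ℝ modulusRate 0 := by
    unfold modulusRate
    exact AnalyticAt.div (by fun_prop) (by fun_prop) (by simp)
  have hκ : ContinuousAt (fun m : ℝ => -16 / ((1 + 4 * m - 4 * m ^ 2) * (1 - 2 * m))) 0 :=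
    ContinuousAt.div (by fun_prop) (by fun_prop) (by simp)
  refine eventually_eq_zero_of_euler_system (r := modulusRate)
    (v := fun m => hypFSq₁ m - hypG₁ (modulusMap m))
    (w := fun m => hypFSq₂ m - hypG₂ (modulusMap m))
    (α := fun m => -16 / ((1 + 4 * m - 4 * m ^ 2) * (1 - 2 * m)) * (3 / 32))
    (β := fun m => -16 / ((1 + 4 * m - 4 * m ^ 2) * (1 - 2 * m)) * (11 / 16))
    (γ := fun m => -16 / ((1 + 4 * m - 4 * m ^ 2) * (1 - 2 * m)) * (3 / 2))
    ((analyticAt_hypFSq (by simp)).sub (analyticAt_hypG_comp (by simp) (by simp [modulusMap_zero])))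
    ?_ hr (by simp [modulusRate]) (hκ.mul_const _) (hκ.mul_const _) (hκ.mul_const _) ?_ ?_ ?_
  · simp [modulusMap_zero, hypF, hypG, powSum_zero, halfCoeff_zero, quarterCoeff]
  all_goals
    filter_upwards [e1, e2, e3, e4] with m h1 h2 h3 h4
    have h5 : 1 - m ≠ 0 := by have := (abs_lt.1 h1).2; linarith
  · obtain ⟨d, hd, hmd⟩ := euler_hypFSq h1 h2 h3
    obtain ⟨d', hd', hmd'⟩ := euler_comp_modulusMap polyBounded_quarterCoeff h2 h5 h4
    have h := (hd.fun_sub hd').deriv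
    change deriv (fun m => (1 - 2 * m) * hypF m ^ 2 - hypG (modulusMap m)) m = _ at h
    rw [h, mul_sub, hmd, hmd', mul_sub]
    rfl
  · obtain ⟨d, hd, hmd⟩ := euler_hypFSq₁ h1 h2 h3
    obtain ⟨d', hd', hmd'⟩ := euler_comp_modulusMap polyBounded_quarterCoeff.nat_mul h2 h5 h4
    have h := (hd.fun_sub hd').deriv
    change deriv (fun m => hypFSq₁ m - hypG₁ (modulusMap m)) m = _ at h
    rw [h, mul_sub, hmd, hmd', mul_sub]
    rfl
  · obtain ⟨d, hd, hmd⟩ := euler_hypFSq₂ h1 h2 h3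
    obtain ⟨d', hd', hmd'⟩ := euler_hypG₂_comp_modulusMap h2 h5 h3 h4
    rw [(hd.fun_sub hd').deriv, mul_sub, hmd, hmd']
    ring

lemma modulusMap_mem_of_mem {m : ℝ} (hm : m ∈ Set.Icc ((1 - √2) / 2) 0) :
    modulusMap m ∈ Set.Icc 0 1 := by
  obtain ⟨h1, h2⟩ := hm
  have h3 : 0 < 1 - 2 * m := by linarith
  constructor
  · exact div_nonneg (by nlinarith) (by positivity)
  · have : 0 ≤ 1 - modulusMap m := by
      rw [one_sub_modulusMap h3.ne']
      positivity
    linarith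

lemma abs_modulusMap_lt_one {m : ℝ} (hm : m ∈ Set.Ioc ((1 - √2) / 2) 0) :
    |modulusMap m| < 1 := by
  obtain ⟨h1, h2⟩ := hm
  have h3 : 0 < 1 - 2 * m := by linarith
  rw [abs_of_nonneg (modulusMap_mem_of_mem ⟨h1.le, h2⟩).1]
  have hs : (1 - 2 * m) ^ 2 < 2 := by
    have h4 : 1 - 2 * m < √2 := by linarith
    calc (1 - 2 * m) ^ 2 < √2 ^ 2 := by gcongr
      _ = 2 := Real.sq_sqrt zero_le_two
  have : 0 < 1 - modulusMap m := by
    rw [one_sub_modulusMap h3.ne']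
    have h5 : 0 < 1 + 4 * m - 4 * m ^ 2 := by nlinarith
    positivity
  linarith

lemma abs_lt_one_of_mem {m : ℝ} (hm : m ∈ Set.Icc ((1 - √2) / 2) 0) : |m| < 1 := by
  have h : √2 < 2 := by rw [Real.sqrt_lt' two_pos]; norm_num
  rw [abs_lt]
  constructor <;> linarith [hm.1, hm.2]

lemma continuousOn_hypG : ContinuousOn hypG (Set.Icc 0 1) := by
  refine continuousOn_tsum (u := quarterCoeff) (fun n => by fun_prop) summable_quarterCoeff ?_
  intro n x hx
  rw [norm_mul, norm_pow, Real.norm_of_nonneg (quarterCoeff_pos n).le, Real.norm_of_nonneg hx.1]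
  exact mul_le_of_le_one_right (quarterCoeff_pos n).le (pow_le_one₀ hx.1 hx.2)

/-- The square of `₂F₁(1/2, 1/2; 1; ·)` as a `₃F₂`: Clausen's formula composed with
quadratic transformations. -/
theorem one_sub_two_mul_mul_hypF_sq {m : ℝ} (hm : m ∈ Set.Icc ((1 - √2) / 2) 0) :
    (1 - 2 * m) * hypF m ^ 2 = hypG (modulusMap m) := by
  have hlt : (1 - √2) / 2 < 0 := by
    have : 1 < √2 := by rw [Real.lt_sqrt zero_le_one]; norm_num
    linarith
  have hne : ∀ m ∈ Set.Icc ((1 - √2) / 2) 0, 1 - 2 * m ≠ 0 := fun m hm => by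
    have := hm.2
    linarith
  have hsub : Set.Ioc ((1 - √2) / 2) 0 ⊆ Set.Icc ((1 - √2) / 2) 0 := Set.Ioc_subset_Icc_self
  have h1 : Set.EqOn (fun m => (1 - 2 * m) * hypF m ^ 2) (fun m => hypG (modulusMap m))
      (Set.Ioc ((1 - √2) / 2) 0) := by
    refine AnalyticOnNhd.eqOn_of_preconnected_of_eventuallyEq (𝕜 := ℝ) (z₀ := 0)
      (fun m hm => analyticAt_hypFSq (abs_lt_one_of_mem (hsub hm)))
      (fun m hm => analyticAt_hypG_comp (hne m (hsub hm)) (abs_modulusMap_lt_one hm))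
      (convex_Ioc _ _).isPreconnected ⟨hlt, le_rfl⟩ ?_
    filter_upwards [eventually_hypFSq_eq] with m hm using sub_eq_zero.1 hm
  refine h1.of_subset_closure (t := Set.Icc ((1 - √2) / 2) 0) (fun m hm =>
    (analyticAt_hypFSq (abs_lt_one_of_mem hm)).continuousAt.continuousWithinAt) ?_ hsub ?_ hm
  · exact continuousOn_hypG.comp
      (fun m hm => (continuousAt_modulusMap (hne m hm)).continuousWithinAt)
      (fun m hm => modulusMap_mem_of_mem hm)
  · rw [closure_Ioc hlt.ne]

lemma poch_one (n : ℕ) : poch 1 n = (n.factorial : ℝ) := by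
  induction n with
  | zero => simp [poch]
  | succ n ih => rw [poch_succ, ih, Nat.factorial_succ]; push_cast; ring

lemma poch_eq_eval (x : ℝ) (n : ℕ) : poch x n = (ascPochhammer ℝ n).eval x := by
  induction n with
  | zero => simp [poch]
  | succ n ih => rw [poch_succ, ih, ascPochhammer_succ_eval]

lemma halfCoeff_eq_choose (n : ℕ) : Ring.choose ((1 / 2 : ℝ) + n - 1) n = halfCoeff n := by
  have h := Ring.factorial_nsmul_multichoose_eq_ascPochhammer (1 / 2 : ℝ) n
  rw [Polynomial.ascPochhammer_smeval_eq_eval, ← poch_eq_eval, nsmul_eq_mul] at h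
  rw [Ring.choose, halfCoeff, poch_one, ← h, mul_div_cancel_left₀ _ (by positivity)]
  congr 1
  ring

lemma hasSum_halfCoeff {t : ℝ} (ht : |t| < 1) :
    HasSum (fun n => halfCoeff n * t ^ n) (1 / √(1 - t)) := by
  have h := (Real.one_div_one_sub_rpow_hasFPowerSeriesOnBall_zero (1 / 2)).hasSum (y := t)
    (by simpa [enorm_eq_nnnorm] using! ht)
  simp only [FormalMultilinearSeries.ofScalars_apply_eq, halfCoeff_eq_choose, zero_add,
    ← Real.sqrt_eq_rpow, smul_eq_mul] at h
  exact h

lemma hasSum_halfCoeff_even {t : ℝ} (ht : |t| < 1) :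
    HasSum (fun n => halfCoeff (2 * n) * t ^ (2 * n)) ((1 / √(1 - t) + 1 / √(1 + t)) / 2) := by
  have h1 := hasSum_halfCoeff ht
  have h2 := hasSum_halfCoeff (t := -t) (by rwa [abs_neg])
  rw [sub_neg_eq_add] at h2
  have h := (h1.add h2).div_const 2
  have hodd : ∀ n ∉ Set.range (2 * · : ℕ → ℕ),
      (halfCoeff n * t ^ n + halfCoeff n * (-t) ^ n) / 2 = 0 := by
    intro n hn
    have : Odd n := by
      rw [← Nat.not_even_iff_odd, even_iff_exists_two_mul]
      exact fun ⟨k, hk⟩ => hn ⟨k, hk.symm⟩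
    rw [this.neg_pow]
    ring
  convert ((mul_right_injective₀ (two_ne_zero' ℕ)).hasSum_iff hodd).2 h using 1
  ext n
  simp only [Function.comp, (even_two_mul n).neg_pow]
  ring

lemma setLIntegral_Ioo_eq_ofReal {f : ℝ → ℝ} {a b : ℝ} (hab : a ≤ b) (hf : Continuous f)
    (h0 : ∀ x, 0 ≤ f x) :
    ∫⁻ x in Set.Ioo a b, ENNReal.ofReal (f x) = ENNReal.ofReal (∫ x in a..b, f x) := by
  rw [intervalIntegral.integral_of_le hab, integral_Ioc_eq_integral_Ioo,
    ofReal_integral_eq_lintegral_ofReal _ (ae_of_all _ h0)]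
  exact (hf.integrableOn_Icc (a := a) (b := b)).mono_set Set.Ioo_subset_Icc_self

lemma integral_cos_pow_two_mul (n : ℕ) :
    ∫ θ in (0 : ℝ)..π / 2, cos θ ^ (2 * n) = π / 2 * halfCoeff n := by
  have hp : ∏ i ∈ Finset.range n, (2 * (i : ℝ) + 1) / (2 * i + 2) = halfCoeff n := by
    induction n with
    | zero => simp [halfCoeff_zero]
    | succ n ih =>
      rw [Finset.prod_range_succ, ih, halfCoeff_succ]
      field_simp
  rw [EulerSine.integral_cos_pow_eq, integral_sin_pow_even, hp]
  ring

lemma lintegral_cos_pow_two_mul (n : ℕ) :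
    ∫⁻ θ in Set.Ioo 0 (π / 2), ENNReal.ofReal (cos θ ^ (2 * n)) =
      ENNReal.ofReal (π / 2 * halfCoeff n) := by
  rw [setLIntegral_Ioo_eq_ofReal (by positivity) (by fun_prop)
    (fun x => (even_two_mul n).pow_nonneg _), integral_cos_pow_two_mul]

lemma lintegral_sin_pow_two_mul (n : ℕ) :
    ∫⁻ θ in Set.Ioo 0 (π / 2), ENNReal.ofReal (sin θ ^ (2 * n)) =
      ENNReal.ofReal (π / 2 * halfCoeff n) := by
  rw [setLIntegral_Ioo_eq_ofReal (by positivity) (by fun_prop)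
    (fun x => (even_two_mul n).pow_nonneg _), ← integral_cos_pow_two_mul]
  have h := intervalIntegral.integral_comp_sub_left (a := 0) (b := π / 2)
    (fun θ : ℝ => cos θ ^ (2 * n)) (π / 2)
  simp only [cos_pi_div_two_sub, sub_self, sub_zero] at h
  rw [h]

/-- The substitution `v = R sin θ`. -/
lemma lintegral_mul_inv_sqrt_sq_sub_sq {R : ℝ} (hR : 0 < R) (h : ℝ → ENNReal) :
    ∫⁻ v in Set.Ioo 0 R, h v * ENNReal.ofReal (1 / √(R ^ 2 - v ^ 2)) =
      ∫⁻ θ in Set.Ioo 0 (π / 2), h (R * sin θ) := by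
  have hcos : ∀ θ ∈ Set.Ioo 0 (π / 2), 0 < cos θ := fun θ hθ =>
    cos_pos_of_mem_Ioo ⟨by linarith [hθ.1, pi_pos], hθ.2⟩
  have himg : (fun θ => R * sin θ) '' Set.Ioo 0 (π / 2) = Set.Ioo 0 R := by
    ext v
    constructor
    · rintro ⟨θ, hθ, rfl⟩
      have h1 : 0 < sin θ := sin_pos_of_pos_of_lt_pi hθ.1 (by linarith [hθ.2, pi_pos])
      have h2 : sin θ < 1 := by
        have := hcos θ hθ
        nlinarith [sin_sq_add_cos_sq θ]
      exact ⟨by positivity, by nlinarith⟩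
    · rintro ⟨h0, h1⟩
      have h2 : v / R < 1 := (div_lt_one hR).2 h1
      refine ⟨arcsin (v / R), ⟨arcsin_pos.2 (by positivity), arcsin_lt_pi_div_two.2 h2⟩, ?_⟩
      have h3 : 0 < v / R := by positivity
      change R * sin (arcsin (v / R)) = v
      rw [sin_arcsin (by linarith) h2.le]
      field_simp
  have hinj : Set.InjOn (fun θ => R * sin θ) (Set.Ioo 0 (π / 2)) := by
    intro x hx y hy hxy
    refine injOn_sin ⟨?_, hx.2.le⟩ ⟨?_, hy.2.le⟩ (mul_left_cancel₀ hR.ne' hxy)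
    · linarith [hx.1, pi_pos]
    · linarith [hy.1, pi_pos]
  rw [← himg, lintegral_image_eq_lintegral_abs_deriv_mul measurableSet_Ioo
    (fun θ _ => ((hasDerivAt_sin θ).const_mul R).hasDerivWithinAt) hinj]
  refine setLIntegral_congr_fun measurableSet_Ioo fun θ hθ => ?_
  have hc := hcos θ hθ
  have hs : √(R ^ 2 - (R * sin θ) ^ 2) = R * cos θ := by
    rw [show R ^ 2 - (R * sin θ) ^ 2 = (R * cos θ) ^ 2 by rw [mul_pow R (cos θ), cos_sq']; ring]
    exact Real.sqrt_sq (by positivity)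
  change ENNReal.ofReal |R * cos θ| * (h (R * sin θ) *
    ENNReal.ofReal (1 / √(R ^ 2 - (R * sin θ) ^ 2))) = h (R * sin θ)
  rw [hs, abs_of_pos (by positivity), mul_left_comm, ← ENNReal.ofReal_mul (by positivity),
    mul_one_div_cancel (by positivity), ENNReal.ofReal_one, mul_one]

/-- Since `√` vanishes on negative reals, the domain of integration can be enlarged to `(0, 1)`. -/
lemma lintegral_unit_mul_inv_sqrt {R : ℝ} (hR : 0 < R) (hR1 : R ≤ 1) (h : ℝ → ENNReal) :
    ∫⁻ v in Set.Ioo 0 1, h v * ENNReal.ofReal (1 / √(R ^ 2 - v ^ 2)) =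
      ∫⁻ θ in Set.Ioo 0 (π / 2), h (R * sin θ) := by
  rw [← lintegral_mul_inv_sqrt_sq_sub_sq hR, ← lintegral_indicator measurableSet_Ioo,
    ← lintegral_indicator measurableSet_Ioo]
  congr 1
  ext v
  by_cases h1 : v ∈ Set.Ioo 0 R
  · rw [Set.indicator_of_mem h1, Set.indicator_of_mem (Set.Ioo_subset_Ioo_right hR1 h1)]
  · rw [Set.indicator_of_notMem h1]
    by_cases h2 : v ∈ Set.Ioo 0 (1 : ℝ)
    · have h3 : R ≤ v := not_lt.1 fun h => h1 ⟨h2.1, h⟩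
      rw [Set.indicator_of_mem h2, Real.sqrt_eq_zero_of_nonpos (by nlinarith)]
      simp
    · rw [Set.indicator_of_notMem h2]

/-- The image of the uniform measure on `(0, π/2)²` under `(α, β) ↦ cos β sin α` has density
the complementary elliptic integral. -/
lemma lintegral_mul_complementary_elliptic {g : ℝ → ENNReal} (hg : Measurable g) :
    ∫⁻ y in Set.Ioo 0 1, g y * ∫⁻ θ in Set.Ioo 0 (π / 2),
        ENNReal.ofReal (1 / √(1 - (1 - y ^ 2) * sin θ ^ 2)) =
      ∫⁻ β in Set.Ioo 0 (π / 2), ∫⁻ α in Set.Ioo 0 (π / 2), g (cos β * sin α) := by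
  have h1 : ∀ y ∈ Set.Ioo (0 : ℝ) 1, g y * ∫⁻ θ in Set.Ioo 0 (π / 2),
      ENNReal.ofReal (1 / √(1 - (1 - y ^ 2) * sin θ ^ 2)) =
      ∫⁻ v in Set.Ioo 0 1, g y * (ENNReal.ofReal (1 / √(1 - v ^ 2)) *
        ENNReal.ofReal (1 / √(1 - y ^ 2 - v ^ 2))) := by
    intro y hy
    have hy2 : 0 < 1 - y ^ 2 := by nlinarith [hy.1, hy.2]
    have h := lintegral_unit_mul_inv_sqrt (Real.sqrt_pos.2 hy2)
      (Real.sqrt_le_one.2 (by nlinarith [hy.1])) (fun v => ENNReal.ofReal (1 / √(1 - v ^ 2)))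
    simp only [mul_pow, Real.sq_sqrt hy2.le] at h
    rw [lintegral_const_mul _ (by fun_prop), h]
  have h2 : ∀ v ∈ Set.Ioo (0 : ℝ) 1, ∫⁻ y in Set.Ioo 0 1,
      g y * (ENNReal.ofReal (1 / √(1 - v ^ 2)) * ENNReal.ofReal (1 / √(1 - y ^ 2 - v ^ 2))) =
      (∫⁻ α in Set.Ioo 0 (π / 2), g (√(1 - v ^ 2) * sin α)) *
        ENNReal.ofReal (1 / √(1 ^ 2 - v ^ 2)) := by
    intro v hv
    have hv2 : 0 < 1 - v ^ 2 := by nlinarith [hv.1, hv.2]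
    have h := lintegral_unit_mul_inv_sqrt (Real.sqrt_pos.2 hv2)
      (Real.sqrt_le_one.2 (by nlinarith [hv.1])) g
    rw [Real.sq_sqrt hv2.le] at h
    rw [← h, mul_comm _ (ENNReal.ofReal _), ← lintegral_const_mul _ (by fun_prop), one_pow]
    refine lintegral_congr fun y => ?_
    rw [sub_right_comm, mul_left_comm]
  rw [setLIntegral_congr_fun measurableSet_Ioo h1, lintegral_lintegral_swap,
    setLIntegral_congr_fun measurableSet_Ioo h2,
    lintegral_unit_mul_inv_sqrt one_pos le_rfl
      (fun v => ∫⁻ α in Set.Ioo 0 (π / 2), g (√(1 - v ^ 2) * sin α))]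
  · refine setLIntegral_congr_fun measurableSet_Ioo fun β hβ => ?_
    have hc : 0 < cos β := cos_pos_of_mem_Ioo ⟨by linarith [hβ.1, pi_pos], hβ.2⟩
    have : √(1 - (1 * sin β) ^ 2) = cos β := by
      rw [one_mul, ← cos_sq', Real.sqrt_sq hc.le]
    simp only [this]
  · refine Measurable.aemeasurable ?_
    unfold Function.uncurry
    fun_prop
lemma measurable_K : Measurable K := by
  have h : StronglyMeasurable (fun p : ℝ × ℝ => 1 / √(1 - p.1 ^ 2 * sin p.2 ^ 2)) :=
    (by fun_prop : Measurable _).stronglyMeasurable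
  exact (h.integral_prod_right' (ν := volume.restrict (Set.Ioo 0 (π / 2)))).measurable

lemma K_nonneg (k : ℝ) : 0 ≤ K k := integral_nonneg fun _ => by positivity

lemma ofReal_K {k : ℝ} (hk : k ^ 2 < 1) :
    ENNReal.ofReal (K k) =
      ∫⁻ θ in Set.Ioo 0 (π / 2), ENNReal.ofReal (1 / √(1 - k ^ 2 * sin θ ^ 2)) := by
  have hpos : ∀ θ : ℝ, √(1 - k ^ 2 * sin θ ^ 2) ≠ 0 := fun θ =>
    (Real.sqrt_pos.2 (by nlinarith [sin_sq_le_one θ, sq_nonneg k, sq_nonneg (sin θ)])).ne'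
  rw [setLIntegral_Ioo_eq_ofReal (by positivity) (by fun_prop (disch := simpa using hpos))
    (fun x => by positivity), intervalIntegral.integral_of_le (by positivity),
    integral_Ioc_eq_integral_Ioo, K]

lemma lintegral_unit_symmetrize (H : ℝ → ENNReal) (hH : Measurable H) :
    ∫⁻ x in Set.Ioo 0 1, H x =
      ∫⁻ y in Set.Ioo 0 1, ENNReal.ofReal (1 / 2) * (H ((1 + y) / 2) + H ((1 - y) / 2)) := by
  have hp : (fun y : ℝ => (1 + y) / 2) '' Set.Ioo 0 1 = Set.Ioo (1 / 2) 1 := by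
    ext x
    constructor
    · rintro ⟨y, hy, rfl⟩
      exact ⟨by linarith [hy.1], by linarith [hy.2]⟩
    · exact fun hx => ⟨2 * x - 1, ⟨by linarith [hx.1], by linarith [hx.2]⟩, by ring⟩
  have hm : (fun y : ℝ => (1 - y) / 2) '' Set.Ico 0 1 = Set.Ioc 0 (1 / 2) := by
    ext x
    constructor
    · rintro ⟨y, hy, rfl⟩
      exact ⟨by linarith [hy.2], by linarith [hy.1]⟩
    · exact fun hx => ⟨1 - 2 * x, ⟨by linarith [hx.2], by linarith [hx.1]⟩, by ring⟩
  have hIp : ∫⁻ x in Set.Ioo (1 / 2) 1, H x =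
      ∫⁻ y in Set.Ioo 0 1, ENNReal.ofReal (1 / 2) * H ((1 + y) / 2) := by
    rw [← hp, lintegral_image_eq_lintegral_abs_deriv_mul measurableSet_Ioo
      (fun y _ => (((hasDerivAt_id' y).const_add 1).div_const 2).hasDerivWithinAt)
      (fun x _ y _ h => by simpa using h)]
    simp [abs_of_pos]
  have hIm : ∫⁻ x in Set.Ioc 0 (1 / 2), H x =
      ∫⁻ y in Set.Ioo 0 1, ENNReal.ofReal (1 / 2) * H ((1 - y) / 2) := by
    rw [← hm, lintegral_image_eq_lintegral_abs_deriv_mul measurableSet_Ico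
      (fun y _ => (((hasDerivAt_id' y).const_sub 1).div_const 2).hasDerivWithinAt)
      (fun x _ y _ h => by simpa using h), setLIntegral_congr Ioo_ae_eq_Ico]
    simp [abs_div]
  simp only [mul_add]
  rw [lintegral_add_left (by fun_prop), ← hIp, ← hIm,
    ← Set.Ioc_union_Ioo_eq_Ioo (b := (1 / 2 : ℝ)) (by norm_num) (by norm_num),
    lintegral_union measurableSet_Ioo, add_comm]
  · exact Set.disjoint_left.2 fun x hx hx' => absurd hx.2 (not_le.2 hx'.1)

lemma lintegral_K_div_sqrt {a : ℝ} :
    ∫⁻ x in Set.Ioo 0 1, ENNReal.ofReal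
        (K (2 * √(x * (1 - x))) / √(1 - 2 * (2 * x - 1) * a + a ^ 2)) =
      ∫⁻ β in Set.Ioo 0 (π / 2), ∫⁻ α in Set.Ioo 0 (π / 2), ENNReal.ofReal
        ((1 / √(1 - 2 * (cos β * sin α) * a + a ^ 2) +
          1 / √(1 + 2 * (cos β * sin α) * a + a ^ 2)) / 2) := by
  have hK := measurable_K
  rw [lintegral_unit_symmetrize _ (by fun_prop), ← lintegral_mul_complementary_elliptic
    (g := fun y => ENNReal.ofReal
      ((1 / √(1 - 2 * y * a + a ^ 2) + 1 / √(1 + 2 * y * a + a ^ 2)) / 2)) (by fun_prop)]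
  refine setLIntegral_congr_fun measurableSet_Ioo fun y hy => ?_
  have hy2 : 0 < 1 - y ^ 2 := by nlinarith [hy.1, hy.2]
  have hk : (2 * √((1 - y ^ 2) / 4)) ^ 2 = 1 - y ^ 2 := by
    rw [mul_pow, Real.sq_sqrt (by positivity)]
    ring
  have hE := ofReal_K (k := 2 * √((1 - y ^ 2) / 4)) (by rw [hk]; nlinarith [hy.1])
  rw [hk] at hE
  have e1 : (1 + y) / 2 * (1 - (1 + y) / 2) = (1 - y ^ 2) / 4 := by ring
  have e2 : (1 - y) / 2 * (1 - (1 - y) / 2) = (1 - y ^ 2) / 4 := by ring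
  have e3 : 1 - 2 * (2 * ((1 + y) / 2) - 1) * a + a ^ 2 = 1 - 2 * y * a + a ^ 2 := by ring
  have e4 : 1 - 2 * (2 * ((1 - y) / 2) - 1) * a + a ^ 2 = 1 + 2 * y * a + a ^ 2 := by ring
  have hK0 := K_nonneg (2 * √((1 - y ^ 2) / 4))
  simp only [e1, e2, e3, e4]
  rw [← hE, ← ENNReal.ofReal_add (by positivity) (by positivity),
    ← ENNReal.ofReal_mul (by positivity), ← ENNReal.ofReal_mul (by positivity)]
  congr 1
  ring

lemma hasSum_sqrt_even {a y : ℝ} (ha0 : 0 ≤ a) (hy0 : 0 ≤ y) (hy1 : y < 1) :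
    HasSum (fun n => halfCoeff (2 * n) * (4 * a ^ 2 / (1 + a ^ 2) ^ 2) ^ n / √(1 + a ^ 2) *
        y ^ (2 * n))
      ((1 / √(1 - 2 * y * a + a ^ 2) + 1 / √(1 + 2 * y * a + a ^ 2)) / 2) := by
  have hq : 2 * a / (1 + a ^ 2) ≤ 1 := by
    rw [div_le_one (by positivity)]
    nlinarith [sq_nonneg (1 - a)]
  have hq0 : 0 ≤ 2 * a / (1 + a ^ 2) := by positivity
  have ht : |2 * a / (1 + a ^ 2) * y| < 1 := by
    rw [abs_of_nonneg (by positivity)]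
    nlinarith
  have e1 : 1 - 2 * y * a + a ^ 2 = (1 - 2 * a / (1 + a ^ 2) * y) * (1 + a ^ 2) := by
    field_simp
    ring
  have e2 : 1 + 2 * y * a + a ^ 2 = (1 + 2 * a / (1 + a ^ 2) * y) * (1 + a ^ 2) := by
    field_simp
    ring
  have hterm : ∀ n, halfCoeff (2 * n) * (4 * a ^ 2 / (1 + a ^ 2) ^ 2) ^ n / √(1 + a ^ 2) *
      y ^ (2 * n) = halfCoeff (2 * n) * (2 * a / (1 + a ^ 2) * y) ^ (2 * n) / √(1 + a ^ 2) := by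
    intro n
    rw [mul_pow _ y, pow_mul (2 * a / (1 + a ^ 2)), div_pow (2 * a), mul_pow 2 a]
    ring
  have hval : (1 / √(1 - 2 * y * a + a ^ 2) + 1 / √(1 + 2 * y * a + a ^ 2)) / 2 =
      (1 / √(1 - 2 * a / (1 + a ^ 2) * y) + 1 / √(1 + 2 * a / (1 + a ^ 2) * y)) / 2 /
        √(1 + a ^ 2) := by
    rw [e1, e2, Real.sqrt_mul' _ (by positivity), Real.sqrt_mul' _ (by positivity),
      ← one_div_mul_one_div, ← one_div_mul_one_div]
    ring
  simp only [hterm]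
  rw [hval]
  exact (hasSum_halfCoeff_even ht).div_const _

lemma lintegral_K_div_sqrt_eq {a : ℝ} (ha0 : 0 ≤ a) :
    ∫⁻ x in Set.Ioo 0 1, ENNReal.ofReal
        (K (2 * √(x * (1 - x))) / √(1 - 2 * (2 * x - 1) * a + a ^ 2)) =
      ENNReal.ofReal (π ^ 2 / 4 / √(1 + a ^ 2) * hypG (4 * a ^ 2 / (1 + a ^ 2) ^ 2)) := by
  set t := 4 * a ^ 2 / (1 + a ^ 2) ^ 2 with ht
  have ht0 : 0 ≤ t := by positivity
  have ht1 : t ≤ 1 := by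
    rw [ht, div_le_one (by positivity)]
    nlinarith [sq_nonneg (1 - a ^ 2)]
  have hb : ∀ n, 0 ≤ halfCoeff (2 * n) * t ^ n / √(1 + a ^ 2) := fun n => by
    have := (halfCoeff_pos (2 * n)).le
    positivity
  have hterm : ∀ β ∈ Set.Ioo 0 (π / 2), ∀ α ∈ Set.Ioo 0 (π / 2),
      ENNReal.ofReal ((1 / √(1 - 2 * (cos β * sin α) * a + a ^ 2) +
        1 / √(1 + 2 * (cos β * sin α) * a + a ^ 2)) / 2) =
      ∑' n, ENNReal.ofReal (halfCoeff (2 * n) * t ^ n / √(1 + a ^ 2)) *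
        ENNReal.ofReal (cos β ^ (2 * n)) * ENNReal.ofReal (sin α ^ (2 * n)) := by
    intro β hβ α hα
    have hc : 0 < cos β := cos_pos_of_mem_Ioo ⟨by linarith [hβ.1, pi_pos], hβ.2⟩
    have hc' : 0 < cos α := cos_pos_of_mem_Ioo ⟨by linarith [hα.1, pi_pos], hα.2⟩
    have hs : 0 < sin α := sin_pos_of_pos_of_lt_pi hα.1 (by linarith [hα.2, pi_pos])
    have hs1 : sin α < 1 := by nlinarith [sin_sq_add_cos_sq α]
    have h := hasSum_sqrt_even ha0 (y := cos β * sin α) (by positivity)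
      (by nlinarith [cos_le_one β])
    rw [← h.tsum_eq, ENNReal.ofReal_tsum_of_nonneg _ h.summable]
    · refine tsum_congr fun n => ?_
      rw [← ENNReal.ofReal_mul (hb n), ← ENNReal.ofReal_mul (by have := hb n; positivity),
        mul_pow, ← mul_assoc]
    · intro n
      have := hb n
      positivity
  have hsum : Summable fun n => quarterCoeff n * t ^ n :=
    Summable.of_nonneg_of_le (fun n => mul_nonneg (quarterCoeff_pos n).le (by positivity))
      (fun n => mul_le_of_le_one_right (quarterCoeff_pos n).le (pow_le_one₀ ht0 ht1))
      summable_quarterCoeff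
  rw [lintegral_K_div_sqrt, setLIntegral_congr_fun measurableSet_Ioo
    fun β hβ => setLIntegral_congr_fun measurableSet_Ioo (hterm β hβ)]
  have hinner : ∀ β : ℝ, ∫⁻ α in Set.Ioo 0 (π / 2),
      ∑' n, ENNReal.ofReal (halfCoeff (2 * n) * t ^ n / √(1 + a ^ 2)) *
        ENNReal.ofReal (cos β ^ (2 * n)) * ENNReal.ofReal (sin α ^ (2 * n)) =
      ∑' n, ENNReal.ofReal (halfCoeff (2 * n) * t ^ n / √(1 + a ^ 2)) *
        ENNReal.ofReal (cos β ^ (2 * n)) * ENNReal.ofReal (π / 2 * halfCoeff n) := by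
    intro β
    rw [lintegral_tsum (fun n => by fun_prop)]
    refine tsum_congr fun n => ?_
    rw [lintegral_const_mul _ (by fun_prop), lintegral_sin_pow_two_mul]
  simp only [hinner]
  rw [lintegral_tsum (fun n => by fun_prop), hypG, powSum, ← tsum_mul_left,
    ENNReal.ofReal_tsum_of_nonneg _ (hsum.mul_left _)]
  · refine tsum_congr fun n => ?_
    rw [lintegral_mul_const _ (by fun_prop), lintegral_const_mul _ (by fun_prop),
      lintegral_cos_pow_two_mul, ← ENNReal.ofReal_mul (hb n), ← ENNReal.ofReal_mul
        (mul_nonneg (hb n) (by have := (halfCoeff_pos n).le; positivity)), quarterCoeff]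
    congr 1
    ring
  · intro n
    have := (quarterCoeff_pos n).le
    positivity

lemma Ksq_eq (m : ℝ) : Ksq m = π / 2 * hypF m := by
  simp only [Ksq, hypF, powSum, halfCoeff, div_pow]

theorem stmt3 (a : ℝ) (ha0 : 0 ≤ a) (ha1 : a ≤ 1) :
    ∫ x in (0:ℝ)..1, K (2 * Real.sqrt (x * (1 - x))) /
        Real.sqrt (1 - 2 * (2 * x - 1) * a + a ^ 2) =
      Ksq ((1 - Real.sqrt (1 + a ^ 2)) / 2) ^ 2 := by
  have hK := measurable_K
  have hs : 0 < √(1 + a ^ 2) := Real.sqrt_pos.2 (by positivity)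
  have hs2 : √(1 + a ^ 2) ^ 2 = 1 + a ^ 2 := Real.sq_sqrt (by positivity)
  have hs1 : 1 ≤ √(1 + a ^ 2) := Real.one_le_sqrt.2 (by nlinarith)
  have hs3 : √(1 + a ^ 2) ≤ √2 := Real.sqrt_le_sqrt (by nlinarith)
  have hmap : modulusMap ((1 - √(1 + a ^ 2)) / 2) = 4 * a ^ 2 / (1 + a ^ 2) ^ 2 := by
    rw [modulusMap, show (1 - 2 * ((1 - √(1 + a ^ 2)) / 2)) ^ 4 = (√(1 + a ^ 2) ^ 2) ^ 2 by ring,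
      show 16 * ((1 - √(1 + a ^ 2)) / 2) * ((1 - √(1 + a ^ 2)) / 2 - 1) =
        4 * (√(1 + a ^ 2) ^ 2 - 1) by ring, hs2]
    congr 1
    ring
  have hF := one_sub_two_mul_mul_hypF_sq (m := (1 - √(1 + a ^ 2)) / 2)
    ⟨by linarith, by linarith⟩
  rw [hmap, show 1 - 2 * ((1 - √(1 + a ^ 2)) / 2) = √(1 + a ^ 2) by ring] at hF
  rw [intervalIntegral.integral_of_le zero_le_one, integral_Ioc_eq_integral_Ioo,
    integral_eq_lintegral_of_nonneg_ae
      (ae_of_all _ fun x => div_nonneg (K_nonneg _) (Real.sqrt_nonneg _))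
      (by fun_prop : Measurable _).aestronglyMeasurable,
    lintegral_K_div_sqrt_eq ha0, ← hF, Ksq_eq, ENNReal.toReal_ofReal (by positivity)]
  field_simp
  ring
end

section
/- The function g(a) = ∫₀¹ K(2√(x(1-x))) / √(1 - 2(2x-1)a + a²) dx satisfies the ODE a²(1+a²) g'''(a) + 3a(1+2a²) g''(a) + (1+7a²) g'(a) + a g(a) = 0 for a ∈ (0,1). -/
open MeasureTheory Real Filter

open Topology

lemma hasDerivAt_inv_sqrt {p : ℝ → ℝ} {p' x : ℝ} (hp : HasDerivAt p p' x) (h0 : 0 < p x) :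
    HasDerivAt (fun y => (√(p y))⁻¹) (-(p' / 2) * (√(p x))⁻¹ ^ 3) x := by
  have hs : √(p x) ≠ 0 := (Real.sqrt_pos.2 h0).ne'
  refine ((hp.sqrt h0.ne').fun_inv hs).congr_deriv ?_
  field_simp

/-- The integrand of the complementary elliptic integral `K (√(1 - u ^ 2))`. -/
noncomputable def ellKer (θ u : ℝ) : ℝ := (√(cos θ ^ 2 + u ^ 2 * sin θ ^ 2))⁻¹

lemma ellKer_radicand_pos {θ : ℝ} (hθ : cos θ ≠ 0) (u : ℝ) :
    0 < cos θ ^ 2 + u ^ 2 * sin θ ^ 2 := by positivity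

lemma ellKer_sq_mul {θ : ℝ} (hθ : cos θ ≠ 0) (u : ℝ) :
    ellKer θ u ^ 2 * (cos θ ^ 2 + u ^ 2 * sin θ ^ 2) = 1 := by
  have h := ellKer_radicand_pos hθ u
  rw [ellKer, inv_pow, Real.sq_sqrt h.le, inv_mul_cancel₀ h.ne']

lemma hasDerivAt_ellKer_right {θ : ℝ} (hθ : cos θ ≠ 0) (u : ℝ) :
    HasDerivAt (ellKer θ) (-(u * sin θ ^ 2) * ellKer θ u ^ 3) u := by
  have h : HasDerivAt (fun v : ℝ => cos θ ^ 2 + v ^ 2 * sin θ ^ 2) (2 * u * sin θ ^ 2) u := by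
    simpa using ((hasDerivAt_pow 2 u).mul_const (sin θ ^ 2)).const_add (cos θ ^ 2)
  refine (hasDerivAt_inv_sqrt h (ellKer_radicand_pos hθ u)).congr_deriv ?_
  rw [ellKer]; ring

lemma hasDerivAt_ellKer_right_deriv {θ : ℝ} (hθ : cos θ ≠ 0) (u : ℝ) :
    HasDerivAt (fun v => -(v * sin θ ^ 2) * ellKer θ v ^ 3)
      (-sin θ ^ 2 * ellKer θ u ^ 3 + 3 * u ^ 2 * sin θ ^ 4 * ellKer θ u ^ 5) u := by
  refine ((((hasDerivAt_id u).mul_const (sin θ ^ 2)).neg).mul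
    ((hasDerivAt_ellKer_right hθ u).pow 3)).congr_deriv ?_
  simp; ring

lemma hasDerivAt_ellKer_left {θ : ℝ} (hθ : cos θ ≠ 0) (u : ℝ) :
    HasDerivAt (fun t => ellKer t u) (sin θ * cos θ * (1 - u ^ 2) * ellKer θ u ^ 3) θ := by
  have h := ((hasDerivAt_cos θ).pow 2).add (((hasDerivAt_sin θ).pow 2).const_mul (u ^ 2))
  refine (hasDerivAt_inv_sqrt h (ellKer_radicand_pos hθ u)).congr_deriv ?_
  simp [ellKer]; ring

lemma continuousOn_ellKer {s : Set (ℝ × ℝ)} (hs : ∀ z ∈ s, cos z.1 ≠ 0) :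
    ContinuousOn (fun z : ℝ × ℝ => ellKer z.1 z.2) s := by
  unfold ellKer
  refine ContinuousOn.inv₀ (by fun_prop) fun z hz => ?_
  exact (Real.sqrt_pos.2 (ellKer_radicand_pos (hs z hz) z.2)).ne'

lemma continuous_ellKer_right {θ : ℝ} (hθ : cos θ ≠ 0) : Continuous (ellKer θ) :=
  continuous_iff_continuousAt.2 fun u => (hasDerivAt_ellKer_right hθ u).continuousAt

/-- The elliptic operator `w ↦ d/du (u (1 - u²) dw/du) - u w` in the variable `u`, applied to
`ellKer θ`. -/
noncomputable def ellOpKer (θ u : ℝ) : ℝ :=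
  u * (1 - u ^ 2) * (-sin θ ^ 2 * ellKer θ u ^ 3 + 3 * u ^ 2 * sin θ ^ 4 * ellKer θ u ^ 5) +
    (1 - 3 * u ^ 2) * (-(u * sin θ ^ 2) * ellKer θ u ^ 3) - u * ellKer θ u

/-- The elliptic operator applied to `ellKer θ` is a total derivative in `θ`. -/
lemma hasDerivAt_ellKer_flux {θ : ℝ} (hθ : cos θ ≠ 0) (u : ℝ) :
    HasDerivAt (fun t => -(u * (sin t * cos t) * ellKer t u ^ 3))
      (ellOpKer θ u) θ := by
  refine (((((hasDerivAt_sin θ).mul (hasDerivAt_cos θ)).const_mul u).mul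
    ((hasDerivAt_ellKer_left hθ u).pow 3)).neg).congr_deriv ?_
  have h1 := ellKer_sq_mul hθ u
  have hc : cos θ ^ 2 = 1 - sin θ ^ 2 := by rw [← Real.sin_sq_add_cos_sq θ]; ring
  simp only [Pi.mul_apply, Pi.pow_apply, ellOpKer]
  generalize ellKer θ u = w at *
  have h3 : w ^ 3 = w ^ 5 * (1 - (1 - u ^ 2) * sin θ ^ 2) := by
    rw [hc] at h1; linear_combination -w ^ 3 * h1
  have hw : w = w ^ 5 * (1 - (1 - u ^ 2) * sin θ ^ 2) ^ 2 := by
    rw [hc] at h1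
    linear_combination (-w - w ^ 3 * (1 - (1 - u ^ 2) * sin θ ^ 2)) * h1
  have hc4 : cos θ * cos θ = 1 - sin θ ^ 2 := by rw [← hc]; ring
  trans -(u * (1 - 2 * sin θ ^ 2) * w ^ 3) -
      3 * u * sin θ ^ 2 * (1 - sin θ ^ 2) * (1 - u ^ 2) * w ^ 5
  · norm_num
    linear_combination (-u * w ^ 3 - 3 * u * sin θ ^ 2 * (1 - u ^ 2) * w ^ 5) * hc
  · linear_combination (u * (1 - 3 * u ^ 2) * sin θ ^ 2 + u * (1 - u ^ 2) * sin θ ^ 2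
      - u * (1 - 2 * sin θ ^ 2)) * h3 + u * hw

lemma abs_mul_cos_le_radicand {θ u : ℝ} (hu : |u| ≤ 1) :
    |u| * cos θ ≤ cos θ ^ 2 + u ^ 2 * sin θ ^ 2 := by
  have hs := Real.sin_sq_add_cos_sq θ
  have h2 : |u| ^ 2 = u ^ 2 := sq_abs u
  have h0 := abs_nonneg u
  have h3 : cos θ ≤ 1 := Real.cos_le_one θ
  have e1 : u ^ 2 ≤ cos θ ^ 2 + u ^ 2 * sin θ ^ 2 := by
    have : sin θ ^ 2 = 1 - cos θ ^ 2 := by linarith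
    rw [this]
    nlinarith [mul_nonneg (sq_nonneg (cos θ)) (by rw [← h2]; nlinarith : 0 ≤ 1 - u ^ 2)]
  have e2 : cos θ ^ 2 ≤ cos θ ^ 2 + u ^ 2 * sin θ ^ 2 := by
    have : 0 ≤ u ^ 2 * sin θ ^ 2 := by positivity
    linarith
  nlinarith [sq_nonneg (|u| - cos θ)]

lemma ellKer_nonneg (θ u : ℝ) : 0 ≤ ellKer θ u := by unfold ellKer; positivity

lemma cos_mul_ellKer_le_one {θ : ℝ} (hθ : 0 < cos θ) (u : ℝ) : cos θ * ellKer θ u ≤ 1 := by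
  rw [ellKer, ← div_eq_mul_inv, div_le_one (Real.sqrt_pos.2 (ellKer_radicand_pos hθ.ne' u))]
  refine Real.le_sqrt_of_sq_le ?_
  have : 0 ≤ u ^ 2 * sin θ ^ 2 := by positivity
  linarith

lemma ellKer_le {θ u : ℝ} (hu : |u| ≤ 1) (hu0 : u ≠ 0) (h0 : 0 ≤ θ) (h1 : θ < π / 2) :
    ellKer θ u ≤ |u| ^ (-(1 / 2) : ℝ) * (1 - 2 / π * θ) ^ (-(1 / 2) : ℝ) := by
  have hc := Real.one_sub_mul_le_cos h0 h1.le
  have hd : 0 < 1 - 2 / π * θ := by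
    have : 2 / π * θ < 2 / π * (π / 2) := by gcongr
    have h : 2 / π * (π / 2) = 1 := by field_simp
    linarith
  have hu' : 0 < |u| := abs_pos.2 hu0
  have hm : |u| * (1 - 2 / π * θ) ≤ cos θ ^ 2 + u ^ 2 * sin θ ^ 2 :=
    (mul_le_mul_of_nonneg_left hc hu'.le).trans (abs_mul_cos_le_radicand hu)
  rw [← Real.mul_rpow hu'.le hd.le, Real.rpow_neg (by positivity), ← Real.sqrt_eq_rpow, ellKer]
  gcongr

lemma measurable_ellKer : Measurable (fun z : ℝ × ℝ => ellKer z.2 z.1) := by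
  unfold ellKer; fun_prop

lemma integrableOn_abs_rpow_neg_half :
    IntegrableOn (fun u : ℝ => |u| ^ (-(1 / 2) : ℝ)) (Set.Ioc (-1) 1) := by
  have h : IntervalIntegrable (fun u : ℝ => |u| ^ (-(1 / 2) : ℝ)) volume 0 1 := by
    refine IntervalIntegrable.congr ?_
      (intervalIntegral.intervalIntegrable_rpow' (r := -(1 / 2)) (by norm_num))
    intro u hu
    rw [Set.uIoc_of_le zero_le_one] at hu
    simp only [abs_of_pos hu.1]
  have h2 : IntervalIntegrable (fun u : ℝ => |u| ^ (-(1 / 2) : ℝ)) volume (-1) 0 := by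
    have := (h.comp_sub_left 0).symm
    simpa using this
  exact (intervalIntegrable_iff_integrableOn_Ioc_of_le (by norm_num)).1 (h2.trans h)

lemma integrableOn_one_sub_rpow_neg_half :
    IntegrableOn (fun θ : ℝ => (1 - 2 / π * θ) ^ (-(1 / 2) : ℝ)) (Set.Ioo 0 (π / 2)) := by
  have h : IntervalIntegrable (fun u : ℝ => u ^ (-(1 / 2) : ℝ)) volume 0 1 :=
    intervalIntegral.intervalIntegrable_rpow' (by norm_num)
  have h2 := ((h.comp_sub_left 1).comp_mul_left (c := 2 / π)).symm
  have e : 1 / (2 / π) = π / 2 := by field_simp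
  have h3 : IntervalIntegrable (fun θ : ℝ => (1 - 2 / π * θ) ^ (-(1 / 2) : ℝ)) volume
      0 (π / 2) := by simpa using h2
  rw [intervalIntegrable_iff_integrableOn_Ioo_of_le (by positivity)] at h3
  exact h3

lemma integrable_ellKer_prod : Integrable (fun z : ℝ × ℝ => ellKer z.2 z.1)
    ((volume.restrict (Set.Ioc (-1) 1)).prod (volume.restrict (Set.Ioo 0 (π / 2)))) := by
  refine Integrable.mono' (integrableOn_abs_rpow_neg_half.integrable.mul_prod
    integrableOn_one_sub_rpow_neg_half.integrable) measurable_ellKer.aestronglyMeasurable ?_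
  rw [Measure.prod_restrict]
  have h0 : ∀ᵐ z : ℝ × ℝ ∂(volume.prod volume), z.1 ≠ 0 := by
    have : ∀ᵐ u : ℝ, u ≠ 0 := by simp [ae_iff]
    exact Measure.quasiMeasurePreserving_fst.ae this
  filter_upwards [ae_restrict_mem (measurableSet_Ioc.prod measurableSet_Ioo),
    ae_restrict_of_ae h0] with z hz hz0
  rw [Real.norm_of_nonneg (ellKer_nonneg _ _)]
  exact ellKer_le (abs_le.2 ⟨hz.1.1.le, hz.1.2⟩) hz0 hz.2.1.le hz.2.2

lemma K_sqrt_one_sub_sq {u : ℝ} (hu : |u| ≤ 1) :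
    K (√(1 - u ^ 2)) = ∫ θ in Set.Ioo 0 (π / 2), ellKer θ u := by
  have h : 0 ≤ 1 - u ^ 2 := by rw [← sq_abs]; nlinarith [abs_nonneg u]
  simp only [K, ellKer, Real.sq_sqrt h, one_div]
  refine integral_congr_ae (Eventually.of_forall fun θ => ?_)
  have : 1 - (1 - u ^ 2) * sin θ ^ 2 = cos θ ^ 2 + u ^ 2 * sin θ ^ 2 := by
    linear_combination -Real.sin_sq_add_cos_sq θ
  simp only [this]

lemma intervalIntegrable_K_sqrt_one_sub_sq :
    IntervalIntegrable (fun u => K (√(1 - u ^ 2))) volume (-1) 1 := by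
  rw [intervalIntegrable_iff_integrableOn_Ioc_of_le (by norm_num)]
  refine integrable_ellKer_prod.integral_prod_left.congr ?_
  filter_upwards [ae_restrict_mem measurableSet_Ioc] with u hu
  exact (K_sqrt_one_sub_sq (abs_le.2 ⟨hu.1.le, hu.2⟩)).symm

lemma integral_ellKer_mul_eq {H H₁ H₂ : ℝ → ℝ} (h : ∀ u ∈ Set.Icc (-1 : ℝ) 1, HasDerivAt H (H₁ u) u)
    (h₁ : ∀ u ∈ Set.Icc (-1 : ℝ) 1, HasDerivAt H₁ (H₂ u) u)
    (h₂ : ContinuousOn H₂ (Set.Icc (-1) 1)) {θ : ℝ} (hθ : cos θ ≠ 0) :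
    ∫ u in (-1 : ℝ)..1,
        ellKer θ u * (u * (1 - u ^ 2) * H₂ u + (1 - 3 * u ^ 2) * H₁ u - u * H u) =
      ∫ u in (-1 : ℝ)..1, ellOpKer θ u * H u := by
  have hI : Set.uIcc (-1 : ℝ) 1 = Set.Icc (-1) 1 := Set.uIcc_of_le (by norm_num)
  have hc : ContinuousOn H (Set.Icc (-1) 1) := HasDerivAt.continuousOn h
  have hc₁ : ContinuousOn H₁ (Set.Icc (-1) 1) := HasDerivAt.continuousOn h₁
  have hw := continuous_ellKer_right hθ
  have i₁ : IntervalIntegrable (fun u => ellKer θ u *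
      (u * (1 - u ^ 2) * H₂ u + (1 - 3 * u ^ 2) * H₁ u - u * H u)) volume (-1) 1 :=
    ContinuousOn.intervalIntegrable (by rw [hI]; fun_prop)
  have i₂ : IntervalIntegrable (fun u => ellOpKer θ u * H u) volume (-1) 1 :=
    ContinuousOn.intervalIntegrable (by rw [hI]; unfold ellOpKer; fun_prop)
  rw [← sub_eq_zero, ← intervalIntegral.integral_sub i₁ i₂]
  rw [intervalIntegral.integral_eq_sub_of_hasDerivAt (f := fun u => u * (1 - u ^ 2) *
    (ellKer θ u * H₁ u - -(u * sin θ ^ 2) * ellKer θ u ^ 3 * H u)) ?_ (i₁.sub i₂)]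
  · norm_num
  · intro u hu
    rw [hI] at hu
    have hp : HasDerivAt (fun v : ℝ => v * (1 - v ^ 2)) (1 - 3 * u ^ 2) u := by
      refine ((hasDerivAt_id u).fun_mul ((hasDerivAt_pow 2 u).const_sub 1)).congr_deriv ?_
      simp; ring
    refine (hp.fun_mul (((hasDerivAt_ellKer_right hθ u).fun_mul (h₁ u hu)).fun_sub
      ((hasDerivAt_ellKer_right_deriv hθ u).fun_mul (h u hu)))).congr_deriv ?_
    simp only [ellOpKer]
    ring

lemma integral_integral_ellOpKer_mul {H : ℝ → ℝ} (hH : ContinuousOn H (Set.Icc (-1) 1)) {β : ℝ}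
    (h0 : 0 ≤ β) (hβ : β < π / 2) :
    ∫ θ in (0 : ℝ)..β, ∫ u in (-1 : ℝ)..1, ellOpKer θ u * H u =
      ∫ u in (-1 : ℝ)..1, -(u * (sin β * cos β) * ellKer β u ^ 3) * H u := by
  have hcos : ∀ θ ∈ Set.Icc 0 β, cos θ ≠ 0 := fun θ hθ =>
    (Real.cos_pos_of_mem_Ioo ⟨by linarith [hθ.1, Real.pi_pos], by linarith [hθ.2]⟩).ne'
  have hop : ContinuousOn (fun z : ℝ × ℝ => ellOpKer z.1 z.2)
      (Set.Icc 0 β ×ˢ Set.Icc (-1) 1) := by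
    have := continuousOn_ellKer (s := Set.Icc 0 β ×ˢ Set.Icc (-1) 1) fun z hz => hcos _ hz.1
    unfold ellOpKer
    fun_prop
  have hI : Set.uIcc (-1 : ℝ) 1 = Set.Icc (-1) 1 := Set.uIcc_of_le (by norm_num)
  have hI' : Set.uIcc 0 β = Set.Icc 0 β := Set.uIcc_of_le h0
  rw [intervalIntegral_intervalIntegral_swap]
  · refine intervalIntegral.integral_congr fun u hu => ?_
    rw [hI] at hu
    simp only [intervalIntegral.integral_mul_const]
    congr 1
    rw [intervalIntegral.integral_eq_sub_of_hasDerivAt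
      (fun θ hθ => hasDerivAt_ellKer_flux (hcos θ (hI' ▸ hθ)) u)]
    · simp
    · refine ContinuousOn.intervalIntegrable ?_
      rw [hI']
      exact hop.comp (f := fun θ => (θ, u)) (by fun_prop) fun θ hθ => ⟨hθ, hu⟩
  · have hc : ContinuousOn (Function.uncurry fun θ u => ellOpKer θ u * H u)
        (Set.Icc 0 β ×ˢ Set.Icc (-1) 1) :=
      hop.mul (hH.comp continuousOn_snd fun z hz => hz.2)
    refine (hc.integrableOn_compact (isCompact_Icc.prod isCompact_Icc)).mono_set ?_
    rw [← hI, ← hI']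
    exact Set.prod_mono Set.uIoc_subset_uIcc Set.uIoc_subset_uIcc

lemma eventually_cos_sin_pos_left_pi_div_two :
    ∀ᶠ β in 𝓝[<] (π / 2), 0 < cos β ∧ 0 < sin β := by
  filter_upwards [Ioo_mem_nhdsLT (show (0 : ℝ) < π / 2 by positivity)] with β hβ
  exact ⟨Real.cos_pos_of_mem_Ioo ⟨by linarith [hβ.1, Real.pi_pos], hβ.2⟩,
    Real.sin_pos_of_pos_of_lt_pi hβ.1 (by linarith [hβ.2, Real.pi_pos])⟩

lemma tendsto_integral_cos_mul_ellKer_mul {f : ℝ → ℝ} (hf : ContinuousOn f (Set.Icc (-1) 1)) :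
    Tendsto (fun β => ∫ u in (-1 : ℝ)..1, cos β * ellKer β u * f u) (𝓝[<] (π / 2)) (𝓝 0) := by
  have hI : Set.uIcc (-1 : ℝ) 1 = Set.Icc (-1) 1 := Set.uIcc_of_le (by norm_num)
  have key := intervalIntegral.tendsto_integral_filter_of_dominated_convergence
    (μ := volume) (a := -1) (b := 1) (l := 𝓝[<] (π / 2))
    (F := fun β u => cos β * ellKer β u * f u) (f := fun _ => 0) (fun u => ‖f u‖) ?_ ?_ ?_ ?_
  · simpa using key
  · filter_upwards [eventually_cos_sin_pos_left_pi_div_two] with β hβ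
    have hw := continuous_ellKer_right hβ.1.ne'
    have : ContinuousOn (fun u => cos β * ellKer β u * f u) (Set.Icc (-1) 1) := by fun_prop
    exact (this.mono (hI ▸ Set.uIoc_subset_uIcc)).aestronglyMeasurable measurableSet_uIoc
  · filter_upwards [eventually_cos_sin_pos_left_pi_div_two] with β hβ
    refine Eventually.of_forall fun u _ => ?_
    rw [norm_mul, Real.norm_of_nonneg (mul_nonneg hβ.1.le (ellKer_nonneg _ _))]
    exact mul_le_of_le_one_left (norm_nonneg _) (cos_mul_ellKer_le_one hβ.1 u)
  · exact ContinuousOn.intervalIntegrable (by rw [hI]; fun_prop)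
  · have h0 : ∀ᵐ u : ℝ, u ≠ 0 := by simp [ae_iff]
    filter_upwards [h0] with u hu _
    have hc : ContinuousAt (fun β => cos β * ellKer β u * f u) (π / 2) := by
      unfold ellKer
      refine ((Real.continuous_cos.continuousAt).mul (ContinuousAt.inv₀ (by fun_prop) ?_)).mul
        continuousAt_const
      simp [Real.sqrt_sq_eq_abs, hu]
    have := hc.tendsto.mono_left (nhdsWithin_le_nhds (s := Set.Iio (π / 2)))
    simpa using this

lemma tendsto_integral_ellKer_flux_mul {H H₁ : ℝ → ℝ}
    (h : ∀ u ∈ Set.Icc (-1 : ℝ) 1, HasDerivAt H (H₁ u) u)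
    (hc₁ : ContinuousOn H₁ (Set.Icc (-1) 1)) :
    Tendsto (fun β => ∫ u in (-1 : ℝ)..1, -(u * (sin β * cos β) * ellKer β u ^ 3) * H u)
      (𝓝[<] (π / 2)) (𝓝 0) := by
  have hI : Set.uIcc (-1 : ℝ) 1 = Set.Icc (-1) 1 := Set.uIcc_of_le (by norm_num)
  have hc : ContinuousOn H (Set.Icc (-1) 1) := HasDerivAt.continuousOn h
  have hcot : Tendsto (fun β => cos β / sin β) (𝓝[<] (π / 2)) (𝓝 0) := by
    have : ContinuousAt (fun β => cos β / sin β) (π / 2) :=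
      Real.continuous_cos.continuousAt.div Real.continuous_sin.continuousAt (by simp)
    simpa using this.tendsto.mono_left (nhdsWithin_le_nhds (s := Set.Iio (π / 2)))
  have hsin : Tendsto (fun β => (sin β)⁻¹) (𝓝[<] (π / 2)) (𝓝 1) := by
    have : ContinuousAt (fun β => (sin β)⁻¹) (π / 2) :=
      Real.continuous_sin.continuousAt.inv₀ (by simp)
    simpa using this.tendsto.mono_left (nhdsWithin_le_nhds (s := Set.Iio (π / 2)))
  have key := (hcot.mul_const (H 1 - H (-1))).sub
    (hsin.mul (tendsto_integral_cos_mul_ellKer_mul hc₁))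
  simp only [zero_mul, mul_zero, sub_zero] at key
  refine key.congr' ?_
  filter_upwards [eventually_cos_sin_pos_left_pi_div_two] with β hβ
  have hw := continuous_ellKer_right hβ.1.ne'
  have ibp := intervalIntegral.integral_mul_deriv_eq_deriv_mul (a := -1) (b := 1)
    (u := H) (v := ellKer β) (fun u hu => h u (hI ▸ hu))
    (fun u _ => hasDerivAt_ellKer_right hβ.1.ne' u)
    (ContinuousOn.intervalIntegrable (by rwa [hI]))
    (Continuous.intervalIntegrable (by fun_prop) _ _)
  have e1 : ellKer β 1 = 1 := by simp [ellKer]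
  have e2 : ellKer β (-1) = 1 := by simp [ellKer]
  rw [e1, e2] at ibp
  have e3 : ∫ u in (-1 : ℝ)..1, -(u * (sin β * cos β) * ellKer β u ^ 3) * H u =
      cos β / sin β * ∫ u in (-1 : ℝ)..1, H u * (-(u * sin β ^ 2) * ellKer β u ^ 3) := by
    rw [← intervalIntegral.integral_const_mul]
    congr 1 with u
    have := hβ.2.ne'
    field_simp
  have e4 : ∫ u in (-1 : ℝ)..1, cos β * ellKer β u * H₁ u =
      cos β * ∫ u in (-1 : ℝ)..1, H₁ u * ellKer β u := by
    rw [← intervalIntegral.integral_const_mul]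
    congr 1 with u
    ring
  rw [e3, ibp, e4]
  ring

/-- `u ↦ K (√(1 - u²))` is a weak solution on `[-1, 1]` of the elliptic equation
`d/du (u (1 - u²) dw/du) = u w`. -/
theorem integral_K_mul_ellOp_eq_zero {H H₁ H₂ : ℝ → ℝ}
    (h : ∀ u ∈ Set.Icc (-1 : ℝ) 1, HasDerivAt H (H₁ u) u)
    (h₁ : ∀ u ∈ Set.Icc (-1 : ℝ) 1, HasDerivAt H₁ (H₂ u) u)
    (h₂ : ContinuousOn H₂ (Set.Icc (-1) 1)) :
    ∫ u in (-1 : ℝ)..1,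
      K (√(1 - u ^ 2)) * (u * (1 - u ^ 2) * H₂ u + (1 - 3 * u ^ 2) * H₁ u - u * H u) = 0 := by
  have hc : ContinuousOn H (Set.Icc (-1) 1) := HasDerivAt.continuousOn h
  have hc₁ : ContinuousOn H₁ (Set.Icc (-1) 1) := HasDerivAt.continuousOn h₁
  set L : ℝ → ℝ := fun u => u * (1 - u ^ 2) * H₂ u + (1 - 3 * u ^ 2) * H₁ u - u * H u with hL
  have hLc : ContinuousOn L (Set.Icc (-1) 1) := by fun_prop
  obtain ⟨M, hM⟩ := isCompact_Icc.exists_bound_of_continuousOn hLc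
  have hint : Integrable (fun z : ℝ × ℝ => ellKer z.2 z.1 * L z.1)
      ((volume.restrict (Set.Ioc (-1) 1)).prod (volume.restrict (Set.Ioo 0 (π / 2)))) := by
    refine integrable_ellKer_prod.mul_bdd (c := M) ?_ ?_
    · exact ((hLc.mono Set.Ioc_subset_Icc_self).aestronglyMeasurable measurableSet_Ioc).comp_fst
    · rw [Measure.prod_restrict]
      filter_upwards [ae_restrict_mem (measurableSet_Ioc.prod measurableSet_Ioo)] with z hz
      exact hM _ (Set.Ioc_subset_Icc_self hz.1)
  have e1 : ∫ u in (-1 : ℝ)..1, K (√(1 - u ^ 2)) * L u =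
      ∫ θ in (0 : ℝ)..(π / 2), ∫ u in (-1 : ℝ)..1, ellKer θ u * L u := by
    rw [intervalIntegral.integral_of_le (by positivity : (0 : ℝ) ≤ π / 2),
      integral_Ioc_eq_integral_Ioo]
    simp_rw [intervalIntegral.integral_of_le (by norm_num : (-1 : ℝ) ≤ 1)]
    rw [← integral_integral_swap hint]
    refine setIntegral_congr_fun measurableSet_Ioc fun u hu => ?_
    rw [K_sqrt_one_sub_sq (abs_le.2 ⟨hu.1.le, hu.2⟩), integral_mul_const]
  have hF : IntervalIntegrable (fun θ => ∫ u in (-1 : ℝ)..1, ellKer θ u * L u) volume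
      0 (π / 2) := by
    rw [intervalIntegrable_iff_integrableOn_Ioo_of_le (by positivity)]
    simp_rw [intervalIntegral.integral_of_le (by norm_num : (-1 : ℝ) ≤ 1)]
    exact hint.integral_prod_right
  have hcont := intervalIntegral.continuousOn_primitive_interval' hF Set.left_mem_uIcc
  have hlim : Tendsto (fun β => ∫ θ in (0 : ℝ)..β, ∫ u in (-1 : ℝ)..1, ellKer θ u * L u)
      (𝓝[<] (π / 2)) (𝓝 (∫ θ in (0 : ℝ)..(π / 2), ∫ u in (-1 : ℝ)..1, ellKer θ u * L u)) := by
    have := (hcont _ Set.right_mem_uIcc).tendsto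
    refine this.mono_left ?_
    rw [Set.uIcc_of_le (by positivity), nhdsWithin_Icc_eq_nhdsLE (by positivity)]
    exact nhdsWithin_mono _ Set.Iio_subset_Iic_self
  rw [e1]
  refine tendsto_nhds_unique hlim ((tendsto_integral_ellKer_flux_mul h hc₁).congr' ?_)
  filter_upwards [Ioo_mem_nhdsLT (show (0 : ℝ) < π / 2 by positivity)] with β hβ
  rw [← integral_integral_ellOpKer_mul hc hβ.1.le hβ.2]
  refine intervalIntegral.integral_congr fun θ hθ => ?_
  rw [Set.uIcc_of_le hβ.1.le] at hθ
  have hcos := Real.cos_pos_of_mem_Ioo (x := θ)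
    ⟨by linarith [hθ.1, Real.pi_pos], by linarith [hθ.2, hβ.2]⟩
  exact (integral_ellKer_mul_eq h h₁ h₂ hcos.ne').symm

lemma hasDerivAt_integral_mul_param {W : ℝ → ℝ} {F F' : ℝ → ℝ → ℝ} {s : Set ℝ} (hs : IsOpen s)
    (hW : IntervalIntegrable W volume (-1) 1)
    (hF : ContinuousOn (Function.uncurry F) (s ×ˢ Set.Icc (-1) 1))
    (hF' : ContinuousOn (Function.uncurry F') (s ×ˢ Set.Icc (-1) 1))
    (hd : ∀ t ∈ s, ∀ u ∈ Set.Icc (-1 : ℝ) 1, HasDerivAt (fun t => F t u) (F' t u) t)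
    {t : ℝ} (ht : t ∈ s) :
    HasDerivAt (fun t => ∫ u in (-1 : ℝ)..1, W u * F t u)
      (∫ u in (-1 : ℝ)..1, W u * F' t u) t := by
  have hI : Set.uIcc (-1 : ℝ) 1 = Set.Icc (-1) 1 := Set.uIcc_of_le (by norm_num)
  have slice : ∀ {Q : ℝ → ℝ → ℝ}, ContinuousOn (Function.uncurry Q) (s ×ˢ Set.Icc (-1) 1) →
      ∀ x ∈ s, IntervalIntegrable (fun u => W u * Q x u) volume (-1) 1 := fun {Q} hQ x hx =>
    hW.mul_continuousOn <| by
      rw [hI]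
      exact hQ.comp (f := fun u => (x, u)) (by fun_prop) fun u hu => ⟨hx, hu⟩
  obtain ⟨ε, hε, hball⟩ := Metric.nhds_basis_closedBall.mem_iff.1 (hs.mem_nhds ht)
  obtain ⟨M, hM⟩ := ((isCompact_closedBall t ε).prod isCompact_Icc).exists_bound_of_continuousOn
    (hF'.mono (Set.prod_mono hball subset_rfl))
  have huI : ∀ u ∈ Set.uIoc (-1 : ℝ) 1, u ∈ Set.Icc (-1 : ℝ) 1 := fun u hu =>
    hI ▸ Set.uIoc_subset_uIcc hu
  refine (intervalIntegral.hasDerivAt_integral_of_dominated_loc_of_deriv_le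
    (F' := fun t u => W u * F' t u) (bound := fun u => ‖W u‖ * M) (Metric.closedBall_mem_nhds t hε) ?_ (slice hF t ht)
    (slice hF' t ht).aestronglyMeasurable_restrict_uIoc ?_ (hW.norm.mul_const M) ?_).2
  · filter_upwards [hs.mem_nhds ht] with x hx
    exact (slice hF x hx).aestronglyMeasurable_restrict_uIoc
  · refine Eventually.of_forall fun u hu x hx => ?_
    rw [norm_mul]
    exact mul_le_mul_of_nonneg_left (hM (x, u) ⟨hx, huI u hu⟩) (norm_nonneg _)
  · exact Eventually.of_forall fun u hu x hx => (hd x (hball hx) u (huI u hu)).const_mul _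

/-- The generating function `1 / √(1 - 2 u t + t²)` of the Legendre polynomials. -/
noncomputable def legendreGen (t u : ℝ) : ℝ := (√(1 - 2 * u * t + t ^ 2))⁻¹

lemma legendreGen_radicand_pos {t u : ℝ} (ht : t ∈ Set.Ioo (0 : ℝ) 1)
    (hu : u ∈ Set.Icc (-1 : ℝ) 1) : 0 < 1 - 2 * u * t + t ^ 2 := by
  nlinarith [mul_nonneg ht.1.le (sub_nonneg.2 hu.2), sq_pos_of_pos (sub_pos.2 ht.2)]

lemma legendreGen_sq_mul {t u : ℝ} (ht : t ∈ Set.Ioo (0 : ℝ) 1) (hu : u ∈ Set.Icc (-1 : ℝ) 1) :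
    legendreGen t u ^ 2 * (1 - 2 * u * t + t ^ 2) = 1 := by
  have h := legendreGen_radicand_pos ht hu
  rw [legendreGen, inv_pow, Real.sq_sqrt h.le, inv_mul_cancel₀ h.ne']

lemma hasDerivAt_legendreGen_left {t u : ℝ} (ht : t ∈ Set.Ioo (0 : ℝ) 1)
    (hu : u ∈ Set.Icc (-1 : ℝ) 1) :
    HasDerivAt (fun s => legendreGen s u) ((u - t) * legendreGen t u ^ 3) t := by
  have h : HasDerivAt (fun s : ℝ => 1 - 2 * u * s + s ^ 2) (-(2 * u) + 2 * t) t := by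
    simpa using (((hasDerivAt_id t).const_mul (2 * u)).const_sub 1).fun_add (hasDerivAt_pow 2 t)
  refine (hasDerivAt_inv_sqrt h (legendreGen_radicand_pos ht hu)).congr_deriv ?_
  rw [legendreGen]; ring

lemma hasDerivAt_legendreGen_right {t u : ℝ} (ht : t ∈ Set.Ioo (0 : ℝ) 1)
    (hu : u ∈ Set.Icc (-1 : ℝ) 1) :
    HasDerivAt (fun v => legendreGen t v) (t * legendreGen t u ^ 3) u := by
  have h : HasDerivAt (fun v : ℝ => 1 - 2 * v * t + t ^ 2) (-(2 * t)) u := by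
    simpa using ((((hasDerivAt_id u).const_mul 2).mul_const t).const_sub 1).add_const (t ^ 2)
  refine (hasDerivAt_inv_sqrt h (legendreGen_radicand_pos ht hu)).congr_deriv ?_
  rw [legendreGen]; ring

lemma continuousOn_legendreGen : ContinuousOn (fun z : ℝ × ℝ => legendreGen z.1 z.2)
    (Set.Ioo 0 1 ×ˢ Set.Icc (-1) 1) := by
  unfold legendreGen
  refine ContinuousOn.inv₀ (by fun_prop) fun z hz => ?_
  exact (Real.sqrt_pos.2 (legendreGen_radicand_pos hz.1 hz.2)).ne'

lemma hasDerivAt_legendreGen_left_two {t u : ℝ} (ht : t ∈ Set.Ioo (0 : ℝ) 1)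
    (hu : u ∈ Set.Icc (-1 : ℝ) 1) :
    HasDerivAt (fun s => (u - s) * legendreGen s u ^ 3)
      (3 * (u - t) ^ 2 * legendreGen t u ^ 5 - legendreGen t u ^ 3) t := by
  refine (((hasDerivAt_id t).const_sub u).fun_mul
    ((hasDerivAt_legendreGen_left ht hu).fun_pow 3)).congr_deriv ?_
  simp; ring

lemma hasDerivAt_legendreGen_left_three {t u : ℝ} (ht : t ∈ Set.Ioo (0 : ℝ) 1)
    (hu : u ∈ Set.Icc (-1 : ℝ) 1) :
    HasDerivAt (fun s => 3 * (u - s) ^ 2 * legendreGen s u ^ 5 - legendreGen s u ^ 3)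
      (15 * (u - t) ^ 3 * legendreGen t u ^ 7 - 9 * (u - t) * legendreGen t u ^ 5) t := by
  have h := hasDerivAt_legendreGen_left ht hu
  refine (((((hasDerivAt_id t).const_sub u).fun_pow 2).const_mul 3).fun_mul
    (h.fun_pow 5) |>.fun_sub (h.fun_pow 3)).congr_deriv ?_
  simp; ring

/-- The third order operator in `t` applied to the Legendre generating function equals the
elliptic operator in `u` applied to `-(1 - t²) (1 - 2 u t + t²) ^ (-3 / 2)`. -/
lemma legendreGen_ode {t u : ℝ} (ht : t ∈ Set.Ioo (0 : ℝ) 1) (hu : u ∈ Set.Icc (-1 : ℝ) 1) :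
    t ^ 2 * (1 + t ^ 2) *
        (15 * (u - t) ^ 3 * legendreGen t u ^ 7 - 9 * (u - t) * legendreGen t u ^ 5) +
      3 * t * (1 + 2 * t ^ 2) *
        (3 * (u - t) ^ 2 * legendreGen t u ^ 5 - legendreGen t u ^ 3) +
      (1 + 7 * t ^ 2) * ((u - t) * legendreGen t u ^ 3) + t * legendreGen t u =
    u * (1 - u ^ 2) * (-(1 - t ^ 2) * (15 * t ^ 2 * legendreGen t u ^ 7)) +
      (1 - 3 * u ^ 2) * (-(1 - t ^ 2) * (3 * t * legendreGen t u ^ 5)) -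
      u * (-(1 - t ^ 2) * legendreGen t u ^ 3) := by
  have h := legendreGen_sq_mul ht hu
  generalize legendreGen t u = r at *
  have h5 : r ^ 5 = r ^ 7 * (1 - 2 * u * t + t ^ 2) := by linear_combination -r ^ 5 * h
  have h3 : r ^ 3 = r ^ 7 * (1 - 2 * u * t + t ^ 2) ^ 2 := by
    linear_combination -r ^ 3 * h + (1 - 2 * u * t + t ^ 2) * h5
  have h1 : r = r ^ 7 * (1 - 2 * u * t + t ^ 2) ^ 3 := by
    linear_combination -r * h + (1 - 2 * u * t + t ^ 2) * h3
  linear_combination (-9 * t ^ 2 * (1 + t ^ 2) * (u - t) + 9 * t * (1 + 2 * t ^ 2) * (u - t) ^ 2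
    + 3 * t * (1 - 3 * u ^ 2) * (1 - t ^ 2)) * h5 +
    (-3 * t * (1 + 2 * t ^ 2) + (1 + 7 * t ^ 2) * (u - t) - u * (1 - t ^ 2)) * h3 + t * h1

lemma integral_K_div_sqrt_eq (t : ℝ) :
    (∫ x in (0 : ℝ)..1, K (2 * √(x * (1 - x))) / √(1 - 2 * (2 * x - 1) * t + t ^ 2)) =
      2⁻¹ * ∫ u in (-1 : ℝ)..1, K (√(1 - u ^ 2)) * legendreGen t u := by
  have h := intervalIntegral.integral_comp_mul_sub (a := 0) (b := 1)
    (fun u => K (√(1 - u ^ 2)) * legendreGen t u) (two_ne_zero (α := ℝ)) 1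
  norm_num at h
  rw [← one_div, ← h]
  refine intervalIntegral.integral_congr fun x _ => ?_
  have e : 2 * √(x * (1 - x)) = √(1 - (2 * x - 1) ^ 2) := by
    rw [show 1 - (2 * x - 1) ^ 2 = 2 ^ 2 * (x * (1 - x)) by ring,
      Real.sqrt_mul (by norm_num : (0 : ℝ) ≤ 2 ^ 2),
      Real.sqrt_sq (by norm_num : (0 : ℝ) ≤ 2)]
  simp only [e, legendreGen, div_eq_mul_inv]

theorem stmt6 (a : ℝ) (ha : a ∈ Set.Ioo (0:ℝ) 1) :
    let g : ℝ → ℝ := fun t => ∫ x in (0:ℝ)..1, K (2 * Real.sqrt (x * (1 - x))) /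
      Real.sqrt (1 - 2 * (2 * x - 1) * t + t ^ 2)
    a ^ 2 * (1 + a ^ 2) * iteratedDeriv 3 g a + 3 * a * (1 + 2 * a ^ 2) * iteratedDeriv 2 g a +
      (1 + 7 * a ^ 2) * deriv g a + a * g a = 0 := by
  intro g
  have hI : Set.uIcc (-1 : ℝ) 1 = Set.Icc (-1) 1 := Set.uIcc_of_le (by norm_num)
  have hW := intervalIntegrable_K_sqrt_one_sub_sq
  have hr := continuousOn_legendreGen
  have c₁ : ContinuousOn (Function.uncurry fun t u => (u - t) * legendreGen t u ^ 3)
      (Set.Ioo 0 1 ×ˢ Set.Icc (-1) 1) := by unfold Function.uncurry; fun_prop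
  have c₂ : ContinuousOn (Function.uncurry fun t u =>
      3 * (u - t) ^ 2 * legendreGen t u ^ 5 - legendreGen t u ^ 3)
      (Set.Ioo 0 1 ×ˢ Set.Icc (-1) 1) := by unfold Function.uncurry; fun_prop
  have c₃ : ContinuousOn (Function.uncurry fun t u =>
      15 * (u - t) ^ 3 * legendreGen t u ^ 7 - 9 * (u - t) * legendreGen t u ^ 5)
      (Set.Ioo 0 1 ×ˢ Set.Icc (-1) 1) := by unfold Function.uncurry; fun_prop
  have hg : g = fun t => 2⁻¹ * ∫ u in (-1 : ℝ)..1, K (√(1 - u ^ 2)) * legendreGen t u :=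
    funext integral_K_div_sqrt_eq
  have d₁ : ∀ t ∈ Set.Ioo (0 : ℝ) 1, deriv g t =
      2⁻¹ * ∫ u in (-1 : ℝ)..1, K (√(1 - u ^ 2)) * ((u - t) * legendreGen t u ^ 3) :=
    fun t ht => hg ▸ ((hasDerivAt_integral_mul_param isOpen_Ioo hW (F := legendreGen) hr c₁
      (fun _ hs _ hu => hasDerivAt_legendreGen_left hs hu) ht).const_mul _).deriv
  have d₂ : ∀ t ∈ Set.Ioo (0 : ℝ) 1, iteratedDeriv 2 g t =
      2⁻¹ * ∫ u in (-1 : ℝ)..1, K (√(1 - u ^ 2)) *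
        (3 * (u - t) ^ 2 * legendreGen t u ^ 5 - legendreGen t u ^ 3) := fun t ht => by
    rw [iteratedDeriv_succ, iteratedDeriv_one,
      EventuallyEq.deriv_eq (eventually_of_mem (isOpen_Ioo.mem_nhds ht) d₁)]
    exact ((hasDerivAt_integral_mul_param isOpen_Ioo hW c₁ c₂
      (fun _ hs _ hu => hasDerivAt_legendreGen_left_two hs hu) ht).const_mul _).deriv
  have d₃ : iteratedDeriv 3 g a =
      2⁻¹ * ∫ u in (-1 : ℝ)..1, K (√(1 - u ^ 2)) *
        (15 * (u - a) ^ 3 * legendreGen a u ^ 7 - 9 * (u - a) * legendreGen a u ^ 5) := by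
    rw [iteratedDeriv_succ,
      EventuallyEq.deriv_eq (eventually_of_mem (isOpen_Ioo.mem_nhds ha) d₂)]
    exact ((hasDerivAt_integral_mul_param isOpen_Ioo hW c₂ c₃
      (fun _ hs _ hu => hasDerivAt_legendreGen_left_three hs hu) ha).const_mul _).deriv
  have hra : ContinuousOn (legendreGen a) (Set.Icc (-1) 1) :=
    hr.comp (f := fun u => (a, u)) (by fun_prop) fun u hu => ⟨ha, hu⟩
  have weak := integral_K_mul_ellOp_eq_zero
    (H := fun u => -(1 - a ^ 2) * legendreGen a u ^ 3)
    (H₁ := fun u => -(1 - a ^ 2) * (3 * a * legendreGen a u ^ 5))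
    (H₂ := fun u => -(1 - a ^ 2) * (15 * a ^ 2 * legendreGen a u ^ 7))
    (fun u hu => (((hasDerivAt_legendreGen_right ha hu).fun_pow 3).const_mul _).congr_deriv
      (by push_cast; ring))
    (fun u hu => ((((hasDerivAt_legendreGen_right ha hu).fun_pow 5).const_mul
      (3 * a)).const_mul _).congr_deriv (by push_cast; ring))
    (by fun_prop)
  have hint : ∀ f : ℝ → ℝ, ContinuousOn f (Set.Icc (-1) 1) →
      IntervalIntegrable (fun u => K (√(1 - u ^ 2)) * f u) volume (-1) 1 := fun f hf =>
    hW.mul_continuousOn (by rwa [hI])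
  have i₀ := (hint _ hra).const_mul a
  have i₁ := (hint (fun u => (u - a) * legendreGen a u ^ 3) (by fun_prop)).const_mul
    (1 + 7 * a ^ 2)
  have i₂ := (hint (fun u => 3 * (u - a) ^ 2 * legendreGen a u ^ 5 - legendreGen a u ^ 3)
    (by fun_prop)).const_mul (3 * a * (1 + 2 * a ^ 2))
  have i₃ := (hint (fun u => 15 * (u - a) ^ 3 * legendreGen a u ^ 7 -
    9 * (u - a) * legendreGen a u ^ 5) (by fun_prop)).const_mul (a ^ 2 * (1 + a ^ 2))
  have total := intervalIntegral.integral_add ((i₃.add i₂).add i₁) i₀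
  rw [intervalIntegral.integral_add (i₃.add i₂) i₁, intervalIntegral.integral_add i₃ i₂] at total
  simp only [intervalIntegral.integral_const_mul] at total
  rw [d₃, d₂ a ha, d₁ a ha, hg]
  have zero : (∫ u in (-1 : ℝ)..1, (a ^ 2 * (1 + a ^ 2) * (K (√(1 - u ^ 2)) *
      (15 * (u - a) ^ 3 * legendreGen a u ^ 7 - 9 * (u - a) * legendreGen a u ^ 5)) +
      3 * a * (1 + 2 * a ^ 2) * (K (√(1 - u ^ 2)) *
      (3 * (u - a) ^ 2 * legendreGen a u ^ 5 - legendreGen a u ^ 3)) +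
      (1 + 7 * a ^ 2) * (K (√(1 - u ^ 2)) * ((u - a) * legendreGen a u ^ 3)) +
      a * (K (√(1 - u ^ 2)) * legendreGen a u))) = 0 := by
    rw [← weak]
    refine intervalIntegral.integral_congr fun u hu => ?_
    rw [← legendreGen_ode ha (hI ▸ hu)]
    ring
  linear_combination -(2⁻¹ : ℝ) * total + 2⁻¹ * zero
end
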